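/- arXiv:2311.05897 — 5 statements merged into one kernel-verified Lean document; each statement's English description precedes it below -/
import Mathlib

section
/- Let f ∈ C(x). The first-order operator L = D + f is stable if and only if f has one of the following two forms: f = -h'/h + α for some nonzero polynomial h ∈ C[x] and some α ∈ C, or f = -h'/h + β/(x - c) for some nonzero polynomial h ∈ C[x] and some β, c ∈ C with β not a positive integer. -/
open Polynomial

/-- The derivative of a rational function, computed via the quotient rule on the
reduced numerator/denominator representation. -/
noncomputable def rderiv {C : Type} [Field C] (f : RatFunc C) : RatFunc C :=
  algebraMap (Polynomial C) (RatFunc C)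
      (derivative f.num * f.denom - f.num * derivative f.denom) /
    algebraMap (Polynomial C) (RatFunc C) (f.denom ^ 2)

/-- The adjoint of the first-order operator `D + f` applied to `r`: `L*(r) = -r' + f*r`. -/
noncomputable def adjD {C : Type} [Field C] (f r : RatFunc C) : RatFunc C :=
  -rderiv r + f * r

/-- A linear differential operator with adjoint action `adj` on `C(x)` is stable if for
every `i ≥ 0` there is a polynomial of degree `i` in the image of the adjoint on `C(x)`. -/
def stableOf {C : Type} [Field C] (adj : RatFunc C → RatFunc C) : Prop :=
  ∀ i : ℕ, ∃ p : Polynomial C, p.degree = (i : ℕ) ∧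
    ∃ r : RatFunc C, adj r = algebraMap (Polynomial C) (RatFunc C) p

section
variable {K : Type} [Field K]

/-- The quotient rule for `rderiv`, for an arbitrary representation as a fraction. -/
theorem rderiv_div (N M : K[X]) (hM : M ≠ 0) :
    rderiv (algebraMap K[X] (RatFunc K) N / algebraMap K[X] (RatFunc K) M) =
      algebraMap K[X] (RatFunc K) (derivative N * M - N * derivative M) /
        algebraMap K[X] (RatFunc K) (M ^ 2) := by
  set r : RatFunc K := algebraMap K[X] (RatFunc K) N / algebraMap K[X] (RatFunc K) M with hr
  have h : r.num * M = N * r.denom := (RatFunc.num_mul_eq_mul_denom_iff hM).2 hr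
  have h' := congrArg derivative h
  simp only [derivative_mul] at h'
  have hd := r.denom_ne_zero
  rw [rderiv, div_eq_div_iff (by simpa using hd) (by simpa using hM), ← map_mul, ← map_mul]
  congr 1
  linear_combination (r.denom * M) * h' +
    (-(r.denom * derivative M) - derivative r.denom * M) * h

theorem rderiv_add (r s : RatFunc K) : rderiv (r + s) = rderiv r + rderiv s := by
  induction r using RatFunc.induction_on with
  | f N M hM =>
  induction s using RatFunc.induction_on with
  | f S Q hQ =>
  have hM' : algebraMap K[X] (RatFunc K) M ≠ 0 := by simpa using hM
  have hQ' : algebraMap K[X] (RatFunc K) Q ≠ 0 := by simpa using hQ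
  rw [div_add_div _ _ hM' hQ', ← map_mul, ← map_mul, ← map_mul, ← map_add,
    rderiv_div _ _ (mul_ne_zero hM hQ), rderiv_div _ _ hM, rderiv_div _ _ hQ]
  simp only [derivative_mul, map_sub, map_add, map_mul, map_pow]
  field_simp
  ring

theorem rderiv_mul (r s : RatFunc K) : rderiv (r * s) = rderiv r * s + r * rderiv s := by
  induction r using RatFunc.induction_on with
  | f N M hM =>
  induction s using RatFunc.induction_on with
  | f S Q hQ =>
  have hM' : algebraMap K[X] (RatFunc K) M ≠ 0 := by simpa using hM
  have hQ' : algebraMap K[X] (RatFunc K) Q ≠ 0 := by simpa using hQ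
  rw [div_mul_div_comm, ← map_mul, ← map_mul,
    rderiv_div _ _ (mul_ne_zero hM hQ), rderiv_div _ _ hM, rderiv_div _ _ hQ]
  simp only [derivative_mul, map_sub, map_add, map_mul, map_pow]
  field_simp
  ring

theorem rderiv_algebraMap (p : K[X]) :
    rderiv (algebraMap K[X] (RatFunc K) p) = algebraMap K[X] (RatFunc K) (derivative p) := by
  simpa using rderiv_div p 1 one_ne_zero

/-- The adjoint `adjD f` as a `K`-linear endomorphism of `RatFunc K`. -/
noncomputable def adjDLinear (f : RatFunc K) : RatFunc K →ₗ[K] RatFunc K where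
  toFun := adjD f
  map_add' r s := by simp only [adjD, rderiv_add]; ring
  map_smul' a r := by
    have h : rderiv (RatFunc.C a) = 0 := by
      rw [← RatFunc.algebraMap_C, rderiv_algebraMap, derivative_C, map_zero]
    simp only [adjD, RatFunc.smul_eq_C_mul, rderiv_mul, h, RingHom.id_apply]
    ring

@[simp]
theorem adjDLinear_apply (f r : RatFunc K) : adjDLinear f r = adjD f r := rfl

/-- `adjD (A / B) (N / M) = p` with denominators cleared. -/
theorem adjD_div_div_eq_iff {A B N M p : K[X]} (hB : B ≠ 0) (hM : M ≠ 0) :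
    adjD (algebraMap K[X] (RatFunc K) A / algebraMap K[X] (RatFunc K) B)
        (algebraMap K[X] (RatFunc K) N / algebraMap K[X] (RatFunc K) M) =
        algebraMap K[X] (RatFunc K) p ↔
      -(derivative N * M - N * derivative M) * B + A * N * M = p * B * M ^ 2 := by
  have hB' : algebraMap K[X] (RatFunc K) B ≠ 0 := by simpa using hB
  have hM' : algebraMap K[X] (RatFunc K) M ≠ 0 := by simpa using hM
  rw [adjD, rderiv_div _ _ hM, ← (RatFunc.algebraMap_injective K).eq_iff]
  simp only [map_sub, map_add, map_mul, map_pow, map_neg]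
  field_simp

/-- The adjoint of `D + g`, with `g` shifted by minus the logarithmic derivative of `h`, at `s / h`. -/
theorem adjD_logDeriv_add_div {h : K[X]} (hh : h ≠ 0) (g : RatFunc K) (s : RatFunc K) :
    adjD (-(algebraMap K[X] (RatFunc K) (derivative h) / algebraMap K[X] (RatFunc K) h) + g)
        (s / algebraMap K[X] (RatFunc K) h) =
      adjD g s / algebraMap K[X] (RatFunc K) h := by
  have hh' : algebraMap K[X] (RatFunc K) h ≠ 0 := by simpa using hh
  have h1 := rderiv_mul (s / algebraMap K[X] (RatFunc K) h) (algebraMap K[X] (RatFunc K) h)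
  rw [div_mul_cancel₀ _ hh', rderiv_algebraMap] at h1
  rw [adjD, adjD, h1]
  field_simp
  ring

/-- A subspace of `K[X]` with elements of every degree is everything. -/
theorem submodule_eq_top_of_forall_degree (V : Submodule K K[X])
    (hV : ∀ i : ℕ, ∃ p ∈ V, p.degree = (i : ℕ)) : V = ⊤ := by
  have key : ∀ n : ℕ, ∀ p : K[X], p.degree < n → p ∈ V := by
    intro n
    induction n with
    | zero =>
      intro p hp
      have : p = 0 := by simpa [Nat.WithBot.lt_zero_iff] using hp
      simp [this]
    | succ n ih =>
      intro p hp
      obtain ⟨q, hqV, hq⟩ := hV n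
      have hqc : q.coeff n ≠ 0 := by
        rw [← natDegree_eq_of_degree_eq_some hq]
        exact leadingCoeff_ne_zero.2 (by rintro rfl; simp at hq)
      have : p - (p.coeff n / q.coeff n) • q ∈ V := by
        refine ih _ ?_
        rw [degree_lt_iff_coeff_zero]
        intro m hm
        rcases hm.eq_or_lt with rfl | hm
        · simp [hqc]
        · rw [degree_lt_iff_coeff_zero] at hp
          have hqm : q.coeff m = 0 :=
            coeff_eq_zero_of_degree_lt (by rw [hq]; exact_mod_cast hm)
          rw [coeff_sub, coeff_smul, hp m hm, hqm]
          simp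
      simpa using V.add_mem this (V.smul_mem (p.coeff n / q.coeff n) hqV)
  exact eq_top_iff.2 fun p _ => key (p.natDegree + 1) p
    (lt_of_le_of_lt degree_le_natDegree (by exact_mod_cast Nat.lt_succ_self _))

/-- A stable first-order operator has every polynomial in the image of its adjoint. -/
theorem exists_adjD_eq_of_stableOf {f : RatFunc K} (hf : stableOf (adjD f)) (p : K[X]) :
    ∃ r, adjD f r = algebraMap K[X] (RatFunc K) p := by
  let V : Submodule K K[X] :=
    (LinearMap.range (adjDLinear f)).comap (IsScalarTower.toAlgHom K K[X] (RatFunc K)).toLinearMap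
  have hV : V = ⊤ := submodule_eq_top_of_forall_degree V fun i => by
    obtain ⟨q, hq, r, hr⟩ := hf i
    exact ⟨q, ⟨r, hr⟩, hq⟩
  have hp : p ∈ V := hV ▸ Submodule.mem_top
  exact hp

theorem stableOf_logDeriv_add {h : K[X]} (hh : h ≠ 0) {g : RatFunc K}
    (hg : ∀ i : ℕ, ∃ p : K[X], p.degree = (i : ℕ) ∧ ∃ s,
      adjD g s = algebraMap K[X] (RatFunc K) p) :
    stableOf (adjD
      (-(algebraMap K[X] (RatFunc K) (derivative h) / algebraMap K[X] (RatFunc K) h) + g)) := by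
  intro i
  obtain ⟨s, hs⟩ := exists_adjD_eq_of_stableOf hg (h * X ^ i)
  refine ⟨X ^ i, degree_X_pow i, s / algebraMap K[X] (RatFunc K) h, ?_⟩
  have hh' : algebraMap K[X] (RatFunc K) h ≠ 0 := by simpa using hh
  rw [adjD_logDeriv_add_div hh, hs, map_mul, mul_div_cancel_left₀ _ hh']

theorem stableOf_adjD_C [CharZero K] (α : K) : stableOf (adjD (RatFunc.C α)) := by
  intro i
  by_cases hα : α = 0
  · refine ⟨derivative (-X ^ (i + 1)), ?_, algebraMap K[X] (RatFunc K) (X ^ (i + 1)), ?_⟩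
    · rw [degree_derivative (by rw [natDegree_neg, natDegree_X_pow]; omega)]
      simp
    · rw [adjD, rderiv_algebraMap, hα, map_zero, zero_mul, add_zero, derivative_neg, map_neg]
  · refine ⟨C α * X ^ i - derivative (X ^ i), ?_, algebraMap K[X] (RatFunc K) (X ^ i), ?_⟩
    · have h1 : (C α * X ^ i : K[X]).degree = i := degree_C_mul_X_pow i hα
      rw [degree_sub_eq_left_of_degree_lt, h1]
      rw [h1]
      exact (degree_derivative_lt (pow_ne_zero i X_ne_zero)).trans_eq (degree_X_pow i)
    · rw [adjD, rderiv_algebraMap, map_sub, map_mul, RatFunc.algebraMap_C]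
      ring

/-- The adjoint of `D + β / (x - c)` at `(x - c) ^ (n + 1)`. -/
theorem adjD_div_X_sub_C_pow (β c : K) (n : ℕ) :
    adjD (RatFunc.C β / (RatFunc.X - RatFunc.C c))
        (algebraMap K[X] (RatFunc K) ((X - C c) ^ (n + 1))) =
      algebraMap K[X] (RatFunc K) (C (β - (n + 1 : ℕ)) * (X - C c) ^ n) := by
  have hX : (RatFunc.X - RatFunc.C c : RatFunc K) = algebraMap K[X] (RatFunc K) (X - C c) := by
    simp [RatFunc.algebraMap_C]
  have h0 : algebraMap K[X] (RatFunc K) (X - C c) ≠ 0 :=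
    (map_ne_zero_iff _ (RatFunc.algebraMap_injective K)).2 (X_sub_C_ne_zero c)
  rw [adjD, rderiv_algebraMap, hX, derivative_X_sub_C_pow, ← RatFunc.algebraMap_C]
  simp only [map_mul, map_pow, map_sub C]
  rw [map_sub (algebraMap K[X] (RatFunc K)) (C β)]
  simp only [map_natCast, Nat.add_sub_cancel]
  field_simp
  ring

theorem stableOf_adjD_div_X_sub_C {β c : K} (hβ : ∀ n : ℕ, 0 < n → β ≠ (n : K)) :
    stableOf (adjD (RatFunc.C β / (RatFunc.X - RatFunc.C c))) := fun i =>
  ⟨C (β - (i + 1 : ℕ)) * (X - C c) ^ i, by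
    rw [degree_mul, degree_C (sub_ne_zero.2 (hβ _ i.succ_pos))]
    simp, _, adjD_div_X_sub_C_pow β c i⟩

/-- Local form of the Wronskian numerator of `N / M` at `c`. -/
theorem exists_local_wronskian {N M : K[X]} (hN : N ≠ 0) (hM : M ≠ 0) (c : K) :
    ∃ u v z : K[X], u.eval c ≠ 0 ∧ v.eval c ≠ 0 ∧
      N = (X - C c) ^ N.rootMultiplicity c * u ∧ M = (X - C c) ^ M.rootMultiplicity c * v ∧
      (X - C c) * (derivative N * M - N * derivative M) =
        (X - C c) ^ (N.rootMultiplicity c + M.rootMultiplicity c) *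
          (C ((N.rootMultiplicity c : K) - M.rootMultiplicity c) * u * v + (X - C c) * z) := by
  have hpow : ∀ n : ℕ, (X - C c) * derivative ((X - C c) ^ n) = C (n : K) * (X - C c) ^ n := by
    rintro (_ | n)
    · simp
    · rw [derivative_X_sub_C_pow, Nat.add_sub_cancel]
      ring
  obtain ⟨u, hu, huc⟩ := exists_eq_pow_rootMultiplicity_mul_and_not_dvd N hN c
  obtain ⟨v, hv, hvc⟩ := exists_eq_pow_rootMultiplicity_mul_and_not_dvd M hM c
  rw [dvd_iff_isRoot, IsRoot.def] at huc hvc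
  refine ⟨u, v, derivative u * v - u * derivative v, huc, hvc, hu, hv, ?_⟩
  generalize N.rootMultiplicity c = a at *
  generalize M.rootMultiplicity c = b at *
  subst hu hv
  have ha := hpow a
  have hb := hpow b
  simp only [derivative_mul]
  rw [C_sub, pow_add]
  linear_combination u * ((X - C c) ^ b * v) * ha - u * ((X - C c) ^ a * v) * hb

theorem rootMultiplicity_le_of_eval_ne_zero [CharZero K] {A B N M p : K[X]} (hN : N ≠ 0)
    (hM : M ≠ 0) {c : K} (hBc : B.eval c ≠ 0)
    (h : -(derivative N * M - N * derivative M) * B + A * N * M = p * B * M ^ 2) :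
    M.rootMultiplicity c ≤ N.rootMultiplicity c := by
  obtain ⟨u, v, z, hu, hv, hN', hM', hW⟩ := exists_local_wronskian hN hM c
  generalize N.rootMultiplicity c = a at *
  generalize M.rootMultiplicity c = b at *
  by_contra! hab
  obtain ⟨d, rfl⟩ := Nat.exists_eq_add_of_lt hab
  have h1 : (X - C c) ^ (a + (a + d + 1)) *
      (-(C ((a : K) - (a + d + 1 : ℕ)) * u * v + (X - C c) * z) * B + (X - C c) * A * u * v) =
      (X - C c) ^ (a + (a + d + 1)) * (p * B * v ^ 2 * (X - C c) ^ (d + 2)) := by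
    rw [hN', hM'] at h hW
    linear_combination (X - C c) * h + B * hW
  have h2 := congrArg (eval c) (mul_left_cancel₀ (pow_ne_zero _ (X_sub_C_ne_zero c)) h1)
  have h3 : (d : K) + 1 ≠ 0 := by exact_mod_cast d.succ_ne_zero
  simp [hu, hv, hBc] at h2
  exact h3 (by linear_combination -h2)

theorem eval_eq_of_rootMultiplicity_lt {A B N M p : K[X]} (hN : N ≠ 0) (hM : M ≠ 0)
    (hB : B ≠ 0) {c : K} (hBc : B.eval c = 0)
    (h : -(derivative N * M - N * derivative M) * B + A * N * M = p * B * M ^ 2)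
    (hlt : N.rootMultiplicity c < M.rootMultiplicity c + B.rootMultiplicity c) :
    A.eval c =
      ((N.rootMultiplicity c : K) - M.rootMultiplicity c) * (derivative B).eval c := by
  obtain ⟨u, v, z, hu, hv, hN', hM', hW⟩ := exists_local_wronskian hN hM c
  obtain ⟨B₁, hB₁, -⟩ := exists_eq_pow_rootMultiplicity_mul_and_not_dvd B hB c
  have hk : 0 < B.rootMultiplicity c := (rootMultiplicity_pos hB).2 hBc
  generalize N.rootMultiplicity c = a at *
  generalize M.rootMultiplicity c = b at *
  generalize B.rootMultiplicity c = k at *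
  obtain ⟨k, rfl⟩ := Nat.exists_eq_add_of_lt hk
  obtain ⟨d, hd⟩ := Nat.exists_eq_add_of_lt hlt
  set B₀ := (X - C c) ^ k * B₁ with hB₀
  have hBB₀ : B = (X - C c) * B₀ := by rw [hB₁, hB₀]; ring
  have h1 : (X - C c) ^ (a + b + 1) *
      (-(C ((a : K) - b) * u * v + (X - C c) * z) * B₀ + A * u * v) =
      (X - C c) ^ (a + b + 1) * (p * B₁ * v ^ 2 * (X - C c) ^ (d + 1)) := by
    have h2 : (X - C c : K[X]) ^ (a + b + 1) * (X - C c) ^ (d + 1) =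
        (X - C c) ^ (2 * b + 1) * (X - C c) ^ (k + 1) := by
      rw [← pow_add, ← pow_add]
      congr 1
      omega
    have h3 : (X - C c) * (-(derivative N * M - N * derivative M) * B + A * N * M) =
        (X - C c) ^ (a + b + 1) *
          (-(C ((a : K) - b) * u * v + (X - C c) * z) * B₀ + A * u * v) := by
      have h4 : A * N * M = A * ((X - C c) ^ a * u) * ((X - C c) ^ b * v) := by
        rw [← hN', ← hM']
      rw [hBB₀]
      linear_combination (-((X - C c) * B₀)) * hW + (X - C c) * h4
    rw [← h3, h, hM', hB₁]
    linear_combination (-(p * B₁ * v ^ 2)) * h2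
  have h2 := congrArg (eval c) (mul_left_cancel₀ (pow_ne_zero _ (X_sub_C_ne_zero c)) h1)
  have h3 : (derivative B).eval c = B₀.eval c := by rw [hBB₀]; simp [derivative_mul]
  rw [h3]
  simp at h2
  have h4 : u.eval c * v.eval c ≠ 0 := mul_ne_zero hu hv
  refine mul_right_cancel₀ h4 ?_
  linear_combination h2
theorem exists_eq_neg_logDeriv_of_adjD_eq_zero [IsAlgClosed K] [CharZero K] {f r : RatFunc K}
    (hf : ∀ p : K[X], ∃ s, adjD f s = algebraMap K[X] (RatFunc K) p) (hr : r ≠ 0)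
    (hr0 : adjD f r = 0) :
    ∃ h : K[X], h ≠ 0 ∧
      f = -(algebraMap K[X] (RatFunc K) (derivative h) / algebraMap K[X] (RatFunc K) h) := by
  have hN0 : r.num ≠ 0 := by simpa using hr
  have hM0 : r.denom ≠ 0 := r.denom_ne_zero
  have hM0' : algebraMap K[X] (RatFunc K) r.denom ≠ 0 := by simpa using hM0
  have hrNM := r.num_div_denom
  have hdeg : r.num.degree = 0 := by
    by_contra hdeg
    obtain ⟨c, hc⟩ := IsAlgClosed.exists_root _ hdeg
    obtain ⟨N₁, hN₁⟩ := dvd_iff_isRoot.2 hc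
    have hN₁0 : N₁ ≠ 0 := by rintro rfl; exact hN0 (by rw [hN₁, mul_zero])
    have hMc : r.denom.eval c ≠ 0 := by
      obtain ⟨a, b, hab⟩ := r.isCoprime_num_denom
      intro h
      have := congrArg (eval c) hab
      rw [IsRoot.def] at hc
      simp [h, hc] at this
    obtain ⟨s, hs⟩ := hf N₁
    set w := s / r with hw
    have hsw : s = w * r := by rw [hw, div_mul_cancel₀ _ hr]
    have h1 : rderiv w * r = -algebraMap K[X] (RatFunc K) N₁ := by
      rw [adjD, hsw, rderiv_mul] at hs
      rw [adjD] at hr0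
      linear_combination w * hr0 - hs
    have hQ0 : w.denom ≠ 0 := w.denom_ne_zero
    have h2 : (X - C c) * (derivative w.num * w.denom - w.num * derivative w.denom) =
        -(r.denom * w.denom ^ 2) := by
      rw [rderiv, ← hrNM, div_mul_div_comm, div_eq_iff (mul_ne_zero (by simpa using hQ0) hM0'),
        ← map_mul, ← map_mul, ← map_neg, ← map_mul,
        (RatFunc.algebraMap_injective K).eq_iff, hN₁] at h1
      refine mul_left_cancel₀ hN₁0 ?_
      linear_combination h1
    have hS0 : w.num ≠ 0 := by
      intro h
      rw [h] at h2
      simp [hM0] at h2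
      exact hQ0 h2
    obtain ⟨u, v, z, hu, hv, -, hQ, hW⟩ := exists_local_wronskian hS0 hQ0 c
    rw [hW] at h2
    generalize w.num.rootMultiplicity c = a at *
    generalize w.denom.rootMultiplicity c = b at *
    rw [hQ] at h2
    have hX := X_sub_C_ne_zero c
    rcases lt_trichotomy a b with hab | rfl | hab
    · obtain ⟨d, rfl⟩ := Nat.exists_eq_add_of_lt hab
      have h3 : (X - C c) ^ (a + (a + d + 1)) *
          (C ((a : K) - (a + d + 1 : ℕ)) * u * v + (X - C c) * z) =
          (X - C c) ^ (a + (a + d + 1)) * (-(r.denom * v ^ 2 * (X - C c) ^ (d + 1))) := by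
        rw [h2]; ring
      have h4 := congrArg (eval c) (mul_left_cancel₀ (pow_ne_zero _ hX) h3)
      have h5 : (d : K) + 1 ≠ 0 := by exact_mod_cast d.succ_ne_zero
      simp [hu, hv] at h4
      exact h5 (by linear_combination -h4)
    · have h3 : (X - C c) ^ (a + a) * (C ((a : K) - a) * u * v + (X - C c) * z) =
          (X - C c) ^ (a + a) * (-(r.denom * v ^ 2)) := by
        rw [h2]; ring
      have h4 := congrArg (eval c) (mul_left_cancel₀ (pow_ne_zero _ hX) h3)
      simp [hv, hMc] at h4
    · obtain ⟨d, rfl⟩ := Nat.exists_eq_add_of_lt hab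
      have h3 : (X - C c) ^ (b + b) * ((X - C c) ^ (d + 1) *
          (C (((b + d + 1 : ℕ) : K) - b) * u * v + (X - C c) * z)) =
          (X - C c) ^ (b + b) * (-(r.denom * v ^ 2)) := by
        linear_combination h2
      have h4 := congrArg (eval c) (mul_left_cancel₀ (pow_ne_zero _ hX) h3)
      simp [hv, hMc] at h4
  obtain ⟨a, ha⟩ : ∃ a, r.num = C a := ⟨_, eq_C_of_degree_eq_zero hdeg⟩
  refine ⟨r.denom, hM0, ?_⟩
  have ha0 : algebraMap K[X] (RatFunc K) (C a) ≠ 0 := by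
    rw [← ha]
    simpa using hr
  have hrd : rderiv r = f * r := by rw [adjD] at hr0; linear_combination -hr0
  rw [rderiv, ← hrNM, RatFunc.num_div_denom, ha, derivative_C] at hrd
  simp only [zero_mul, zero_sub, map_neg, map_mul, map_pow] at hrd
  have hr' : r * algebraMap K[X] (RatFunc K) r.denom = algebraMap K[X] (RatFunc K) (C a) := by
    rw [← ha, ← div_eq_iff_mul_eq hM0', hrNM]
  field_simp at hrd ⊢
  refine mul_left_cancel₀ ha0 ?_
  linear_combination -hrd - algebraMap K[X] (RatFunc K) r.denom * f * hr'

/-- Dimension count for the operator sending `t` to `A * t` minus the derivative of `B * t`. -/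
theorem natDegree_le_card_of_ker_le [CharZero K] {A B : K[X]} (hA : A ≠ 0) (hB : B ≠ 0)
    (E : Finset K) (φ : K[X] →ₗ[K] (E → K))
    (hφ : ∀ p, φ p = 0 → ∃ t, p = (A - derivative B) * t - B * derivative t) :
    A.natDegree ≤ E.card ∧ B.natDegree ≤ E.card + 1 := by
  obtain ⟨D, hD⟩ : ∃ D, D = max A.natDegree (B.natDegree - 1) := ⟨_, rfl⟩
  have hAD : A.natDegree ≤ D := by omega
  have hBD : B.natDegree ≤ D + 1 := by omega
  suffices D ≤ E.card by omega
  let T : K[X] →ₗ[K] K[X] :=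
    LinearMap.mulLeft K (A - derivative B) - LinearMap.mulLeft K B ∘ₗ derivative
  have hT : ∀ t, T t = (A - derivative B) * t - B * derivative t := fun t => rfl
  have hcoeff : ∀ (t : K[X]) (n : ℕ), t.natDegree ≤ n + 1 → (T t).coeff (D + (n + 1)) =
      (A.coeff D - (D + 1 + (n + 1 : ℕ)) * B.coeff (D + 1)) * t.coeff (n + 1) := by
    intro t n ht
    have h1 : (A - derivative B).natDegree ≤ D :=
      (natDegree_sub_le _ _).trans
        (max_le hAD ((natDegree_derivative_le B).trans (by omega)))
    have h2 : (derivative t).natDegree ≤ n := (natDegree_derivative_le t).trans (by omega)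
    rw [hT, coeff_sub, coeff_mul_add_eq_of_natDegree_le h1 ht,
      show D + (n + 1) = (D + 1) + n by ring, coeff_mul_add_eq_of_natDegree_le hBD h2, coeff_sub,
      coeff_derivative, coeff_derivative]
    push_cast
    ring
  obtain ⟨N, hN⟩ : ∃ N : ℕ, ∀ n, N < n →
      A.coeff D - (D + 1 + (n : K)) * B.coeff (D + 1) ≠ 0 := by
    by_cases hb : B.coeff (D + 1) = 0
    · refine ⟨0, fun n _ => ?_⟩
      rw [hb, mul_zero, sub_zero]
      by_cases h : B.natDegree - 1 ≤ A.natDegree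
      · rw [hD, max_eq_left h]
        exact leadingCoeff_ne_zero.2 hA
      · have : D + 1 = B.natDegree := by omega
        rw [this] at hb
        exact absurd hb (leadingCoeff_ne_zero.2 hB)
    · by_cases h : ∃ n₀ : ℕ, A.coeff D - (D + 1 + (n₀ : K)) * B.coeff (D + 1) = 0
      · obtain ⟨n₀, hn₀⟩ := h
        refine ⟨n₀, fun n hn h => hn.ne ?_⟩
        have : (n₀ : K) = n := mul_right_cancel₀ hb (by linear_combination h - hn₀)
        exact_mod_cast this
      · exact ⟨0, fun n _ hn => h ⟨n, hn⟩⟩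
  have hfin : ∀ n, Module.Finite K (degreeLT K n) := fun n =>
    Module.Finite.equiv (degreeLTEquiv K n).symm
  have hrank : ∀ n, Module.finrank K (degreeLT K n) = n := fun n => by
    rw [(degreeLTEquiv K n).finrank_eq, Module.finrank_fin_fun]
  let V := degreeLT K (N + D + 1)
  let ψ : V →ₗ[K] (E → K) := φ.domRestrict V
  have hle : (LinearMap.ker ψ).map V.subtype ≤ (degreeLT K (N + 1)).map T := by
    rintro _ ⟨⟨p, hpV⟩, hp, rfl⟩
    obtain ⟨t, ht⟩ := hφ p hp
    refine ⟨t, ?_, (hT t).trans ht.symm⟩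
    by_contra htN
    rw [SetLike.mem_coe, mem_degreeLT, not_lt] at htN
    have ht0 : t ≠ 0 := by
      rintro rfl
      simp at htN
    have htN' : N + 1 ≤ t.natDegree := le_natDegree_of_coe_le_degree htN
    obtain ⟨n, hn⟩ := Nat.exists_eq_add_of_le' (show 1 ≤ t.natDegree by omega)
    have h1 := hcoeff t n hn.le
    rw [hT, ← ht] at h1
    have h2 : p.coeff (D + (n + 1)) = 0 := by
      rw [mem_degreeLT, degree_lt_iff_coeff_zero] at hpV
      exact hpV _ (by omega)
    rw [h2] at h1
    refine mul_ne_zero (hN (n + 1) (by omega)) ?_ h1.symm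
    rw [← hn]
    exact leadingCoeff_ne_zero.2 ht0
  have h1 := LinearMap.finrank_range_add_finrank_ker ψ
  have h2 : Module.finrank K (LinearMap.range ψ) ≤ E.card := by
    simpa using Submodule.finrank_le (LinearMap.range ψ)
  have h3 := Submodule.finrank_mono hle
  have h4 := Submodule.finrank_map_le T (degreeLT K (N + 1))
  rw [Submodule.finrank_map_subtype_eq] at h3
  rw [hrank] at h1 h4
  omega

theorem dvd_of_rootMultiplicity_le [IsAlgClosed K] {p q : K[X]} (hp : p ≠ 0)
    (hq : q ≠ 0) (h : ∀ c, p.rootMultiplicity c ≤ q.rootMultiplicity c) : p ∣ q := by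
  classical
  rw [IsAlgClosed.dvd_iff_roots_le_roots hp hq, Multiset.le_iff_count]
  simpa only [count_roots] using h

theorem nodal_dvd_of_forall_eval_eq_zero {E : Finset K} {p : K[X]}
    (h : ∀ c ∈ E, p.eval c = 0) : Lagrange.nodal E id ∣ p := by
  rw [Lagrange.nodal_eq]
  exact Finset.prod_dvd_of_coprime
    ((pairwise_coprime_X_sub_C (s := id) Function.injective_id).set_pairwise _)
    fun c hc => dvd_iff_isRoot.2 (h c hc)

theorem eval_prod_X_sub_C_pow_ne_zero {E : Finset K} (m : K → ℕ) {c : K} (hc : c ∉ E) :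
    (∏ d ∈ E, (X - C d) ^ m d).eval c ≠ 0 := by
  rw [eval_prod, Finset.prod_ne_zero_iff]
  intro d hd
  rw [eval_pow, eval_sub, eval_X, eval_C]
  exact pow_ne_zero _ (sub_ne_zero.2 (by rintro rfl; exact hc hd))

theorem prod_X_sub_C_pow_ne_zero (E : Finset K) (m : K → ℕ) :
    (∏ d ∈ E, (X - C d) ^ m d) ≠ 0 :=
  Finset.prod_ne_zero_iff.2 fun d _ => pow_ne_zero _ (X_sub_C_ne_zero d)

theorem rootMultiplicity_prod_X_sub_C_pow_of_notMem {E : Finset K} (m : K → ℕ) {c : K}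
    (hc : c ∉ E) : (∏ d ∈ E, (X - C d) ^ m d).rootMultiplicity c = 0 :=
  rootMultiplicity_eq_zero (eval_prod_X_sub_C_pow_ne_zero m hc)

theorem rootMultiplicity_prod_X_sub_C_pow {E : Finset K} (m : K → ℕ) {c : K} (hc : c ∈ E) :
    (∏ d ∈ E, (X - C d) ^ m d).rootMultiplicity c = m c := by
  classical
  have h0 := prod_X_sub_C_pow_ne_zero E m
  rw [← Finset.mul_prod_erase E _ hc] at h0 ⊢
  rw [rootMultiplicity_mul h0, rootMultiplicity_X_sub_C_pow,
    rootMultiplicity_prod_X_sub_C_pow_of_notMem m (Finset.notMem_erase c E), add_zero]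

theorem exists_comp_eq_of_forall_exists {U V W : Type} [AddCommGroup U] [Module K U]
    [AddCommGroup V] [Module K V] [AddCommGroup W] [Module K W] {i : V →ₗ[K] W}
    (hi : Function.Injective i) {j : U →ₗ[K] W} (h : ∀ u, ∃ v, i v = j u) :
    ∃ l : U →ₗ[K] V, ∀ u, i (l u) = j u :=
  ⟨(LinearEquiv.ofInjective i hi).symm ∘ₗ j.codRestrict (LinearMap.range i) h, fun u => by
    have := LinearEquiv.apply_symm_apply (LinearEquiv.ofInjective i hi)
      (j.codRestrict (LinearMap.range i) h u)
    exact congrArg Subtype.val this⟩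

/-- If the residue of `A / B` is `-m c` at each `c ∈ E`, then the logarithmic derivative of
`∏ c ∈ E, (X - c) ^ m c` cancels the poles of `A / B` at `E`. -/
theorem exists_eq_neg_logDeriv_add_div {A B : K[X]} (hB : B.Monic) (E : Finset K) (m : K → ℕ)
    (hBE : ∀ c ∈ E, B.eval c = 0)
    (hAE : ∀ c ∈ E, A.eval c = -(m c : K) * (derivative B).eval c)
    (hAdeg : A.natDegree ≤ E.card) (hBdeg : B.natDegree ≤ E.card + 1) :
    ∃ (Q : K[X]) (g : K), Q.Monic ∧ Q.natDegree ≤ 1 ∧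
      algebraMap K[X] (RatFunc K) A / algebraMap K[X] (RatFunc K) B =
        -(algebraMap K[X] (RatFunc K) (derivative (∏ c ∈ E, (X - C c) ^ m c)) /
          algebraMap K[X] (RatFunc K) (∏ c ∈ E, (X - C c) ^ m c)) +
        algebraMap K[X] (RatFunc K) (C g) / algebraMap K[X] (RatFunc K) Q := by
  classical
  have hh := prod_X_sub_C_pow_ne_zero E m
  set h := ∏ c ∈ E, (X - C c) ^ m c with hh_def
  set H := Lagrange.nodal E id with hH
  have hHm : H.Monic := Lagrange.nodal_monic
  have hHdeg : H.natDegree = E.card := Lagrange.natDegree_nodal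
  obtain ⟨Q, hQ⟩ := nodal_dvd_of_forall_eval_eq_zero hBE
  rw [← hH] at hQ
  have hQm : Q.Monic := hHm.of_mul_monic_left (hQ ▸ hB)
  have hQdeg : E.card + Q.natDegree = B.natDegree := by
    rw [hQ, hHm.natDegree_mul hQm, hHdeg]
  set L := ∑ c ∈ E, C (m c : K) * Lagrange.nodal (E.erase c) id with hL
  have hlog : derivative h * H = h * L := by
    rw [hh_def, derivative_prod_finset, hL, Finset.sum_mul, Finset.mul_sum]
    refine Finset.sum_congr rfl fun c hc => ?_
    rw [hH, Lagrange.nodal_eq_mul_nodal_erase hc, ← Finset.mul_prod_erase E _ hc]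
    rcases m c with _ | k
    · simp
    · rw [derivative_X_sub_C_pow, Nat.add_sub_cancel, id_eq]
      simp only [map_natCast]
      ring
  have hLdeg : L.natDegree ≤ E.card - 1 := by
    refine natDegree_sum_le_of_forall_le _ _ fun c hc => ?_
    refine (natDegree_C_mul_le _ _).trans ?_
    rw [Lagrange.natDegree_nodal, Finset.card_erase_of_mem hc]
  have hLE : ∀ c ∈ E, L.eval c = (m c : K) * (derivative H).eval c := by
    intro c hc
    have h1 := Lagrange.eval_nodal_derivative_eval_node_eq (v := id) hc
    rw [id_eq] at h1
    rw [hH, h1, hL, eval_finsetSum, Finset.sum_eq_single_of_mem c hc]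
    · rw [eval_mul, eval_C]
    · intro d _ hd
      have := Lagrange.eval_nodal_at_node (v := (id : K → K))
        (Finset.mem_erase.2 ⟨hd.symm, hc⟩)
      rw [id_eq] at this
      rw [eval_mul, this, mul_zero]
  have hnum : ∀ c ∈ E, (A + L * Q).eval c = 0 := by
    intro c hc
    have hHc : H.eval c = 0 := Lagrange.eval_nodal_at_node (v := (id : K → K)) hc
    rw [eval_add, eval_mul, hAE c hc, hLE c hc, hQ, derivative_mul, eval_add, eval_mul, eval_mul,
      hHc]
    ring
  obtain ⟨G, hG⟩ := nodal_dvd_of_forall_eval_eq_zero hnum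
  rw [← hH] at hG
  have hnumdeg : (A + L * Q).natDegree ≤ E.card := by
    refine (natDegree_add_le _ _).trans (max_le hAdeg ?_)
    rcases E.eq_empty_or_nonempty with rfl | hE
    · simp [hL]
    · have := hE.card_pos
      exact natDegree_mul_le.trans (by omega)
  have hGdeg : G.natDegree = 0 := by
    by_cases hG0 : G = 0
    · simp [hG0]
    · rw [hG, hHm.natDegree_mul' hG0] at hnumdeg
      omega
  refine ⟨Q, G.coeff 0, hQm, by omega, ?_⟩
  rw [← eq_C_of_natDegree_eq_zero hGdeg]
  have hne {p : K[X]} : algebraMap K[X] (RatFunc K) p ≠ 0 ↔ p ≠ 0 :=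
    map_ne_zero_iff _ (RatFunc.algebraMap_injective K)
  have hh' := hne.2 hh
  have hH' := hne.2 hHm.ne_zero
  have hQ' := hne.2 hQm.ne_zero
  have hG' := congrArg (algebraMap K[X] (RatFunc K)) hG
  have hlog' := congrArg (algebraMap K[X] (RatFunc K)) hlog
  simp only [map_add, map_mul] at hG' hlog'
  rw [hQ, map_mul]
  field_simp
  linear_combination algebraMap K[X] (RatFunc K) h * hG' +
    algebraMap K[X] (RatFunc K) Q * hlog'
/-- If the adjoint of `D + A / B` is injective on `K(x)` and its image contains all polynomials,
then `A` and `B` have degrees bounded by the number of simple poles with residue a negative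
integer. -/
theorem exists_negative_residues [IsAlgClosed K] [CharZero K] {A B : K[X]} (hB : B ≠ 0)
    (hAB : IsCoprime A B)
    (hsurj : ∀ p : K[X], ∃ r, adjD (algebraMap K[X] (RatFunc K) A / algebraMap K[X] (RatFunc K) B) r
      = algebraMap K[X] (RatFunc K) p)
    (hinj : ∀ r, adjD (algebraMap K[X] (RatFunc K) A / algebraMap K[X] (RatFunc K) B) r = 0 →
      r = 0) :
    ∃ (E : Finset K) (m : K → ℕ), (∀ c ∈ E, B.eval c = 0) ∧
      (∀ c ∈ E, A.eval c = -(m c : K) * (derivative B).eval c) ∧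
      A.natDegree ≤ E.card ∧ B.natDegree ≤ E.card + 1 := by
  classical
  set f := algebraMap K[X] (RatFunc K) A / algebraMap K[X] (RatFunc K) B with hf
  have hne {p : K[X]} : algebraMap K[X] (RatFunc K) p ≠ 0 ↔ p ≠ 0 :=
    map_ne_zero_iff _ (RatFunc.algebraMap_injective K)
  have hA : A ≠ 0 := by
    rintro rfl
    refine one_ne_zero (hinj 1 ?_)
    have : rderiv (1 : RatFunc K) = 0 := by simpa using rderiv_algebraMap (1 : K[X])
    simp [adjD, this, hf]
  have hAc : ∀ c, B.eval c = 0 → A.eval c ≠ 0 := by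
    intro c hBc hAc
    obtain ⟨a, b, hab⟩ := hAB
    have := congrArg (eval c) hab
    simp [hBc, hAc] at this
  let E : Finset K := B.roots.toFinset.filter fun c =>
    ∃ n : ℕ, 0 < n ∧ A.eval c = -(n : K) * (derivative B).eval c
  have hE : ∀ c, c ∈ E ↔ B.eval c = 0 ∧
      ∃ n : ℕ, 0 < n ∧ A.eval c = -(n : K) * (derivative B).eval c := by
    intro c
    simp [E, hB]
  have hm : ∀ c, ∃ n : ℕ, c ∈ E → A.eval c = -(n : K) * (derivative B).eval c := by
    intro c
    by_cases hc : c ∈ E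
    · obtain ⟨-, n, -, hn⟩ := (hE c).1 hc
      exact ⟨n, fun _ => hn⟩
    · exact ⟨0, fun h => absurd h hc⟩
  choose m hm using hm
  have hm_unique : ∀ c ∈ E, ∀ x : K, A.eval c = x * (derivative B).eval c → x = -(m c : K) := by
    intro c hc x hx
    have h1 : (derivative B).eval c ≠ 0 := by
      intro h
      exact hAc c ((hE c).1 hc).1 (by rw [hx, h, mul_zero])
    exact mul_right_cancel₀ h1 (hx.symm.trans (hm c hc))
  refine ⟨E, m, fun c hc => ((hE c).1 hc).1, hm, ?_⟩
  have hh := prod_X_sub_C_pow_ne_zero E m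
  have hhE := fun c (hc : c ∈ E) => rootMultiplicity_prod_X_sub_C_pow m hc
  have hhE' := fun c (hc : c ∉ E) => rootMultiplicity_prod_X_sub_C_pow_of_notMem m hc
  set h := ∏ c ∈ E, (X - C c) ^ m c
  let ι : K[X] →ₗ[K] RatFunc K := (IsScalarTower.toAlgHom K K[X] (RatFunc K)).toLinearMap
  let i : K[X] →ₗ[K] RatFunc K :=
    adjDLinear f ∘ₗ LinearMap.mulRight K (algebraMap K[X] (RatFunc K) h)⁻¹ ∘ₗ ι
  have hi : ∀ s, i s = adjD f (algebraMap K[X] (RatFunc K) s / algebraMap K[X] (RatFunc K) h) :=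
    fun s => by rw [div_eq_mul_inv]; rfl
  have hi_inj : Function.Injective i := by
    rw [← LinearMap.ker_eq_bot, LinearMap.ker_eq_bot']
    intro s hs
    rw [hi] at hs
    by_contra hs0
    exact div_ne_zero (hne.2 hs0) (hne.2 hh) (hinj _ hs)
  have hi_surj : ∀ p, ∃ s, i s = ι p := by
    intro p
    obtain ⟨r, hr⟩ := hsurj p
    by_cases hr0 : r = 0
    · refine ⟨0, ?_⟩
      rw [map_zero]
      rw [hr0, ← adjDLinear_apply, map_zero] at hr
      exact hr
    have hN : r.num ≠ 0 := by simpa using hr0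
    have hM := r.denom_ne_zero
    rw [← r.num_div_denom] at hr
    have heq := (adjD_div_div_eq_iff hB hM).1 hr
    have hdvd : r.denom ∣ h * r.num := by
      refine dvd_of_rootMultiplicity_le hM (mul_ne_zero hh hN) fun c => ?_
      rw [rootMultiplicity_mul (mul_ne_zero hh hN)]
      by_cases hBc : B.eval c = 0
      · by_contra! hlt
        have hA' := eval_eq_of_rootMultiplicity_lt hN hM hB hBc heq (by omega)
        have hcE : c ∈ E := by
          refine (hE c).2 ⟨hBc, r.denom.rootMultiplicity c - r.num.rootMultiplicity c,
            by omega, ?_⟩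
          rw [hA', Nat.cast_sub (by omega)]
          ring
        have h1 := hm_unique c hcE _ hA'
        have h2 : r.num.rootMultiplicity c + m c = r.denom.rootMultiplicity c := by
          have : ((r.num.rootMultiplicity c + m c : ℕ) : K) = r.denom.rootMultiplicity c := by
            push_cast
            linear_combination h1
          exact_mod_cast this
        rw [hhE c hcE] at hlt
        omega
      · exact (rootMultiplicity_le_of_eval_ne_zero hN hM hBc heq).trans (by omega)
    obtain ⟨s, hs⟩ := hdvd
    refine ⟨s, ?_⟩
    have h3 : algebraMap K[X] (RatFunc K) s / algebraMap K[X] (RatFunc K) h =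
        algebraMap K[X] (RatFunc K) r.num / algebraMap K[X] (RatFunc K) r.denom := by
      rw [div_eq_div_iff (hne.2 hh) (hne.2 hM), ← map_mul, ← map_mul]
      congr 1
      linear_combination -hs
    rw [hi, h3]
    exact hr
  obtain ⟨Θ, hΘ⟩ := exists_comp_eq_of_forall_exists hi_inj hi_surj
  refine natDegree_le_card_of_ker_le hA hB E (LinearMap.pi fun c => leval c.1 ∘ₗ Θ) ?_
  intro p hp
  have hpE : ∀ c ∈ E, (Θ p).eval c = 0 := fun c hc => congrFun hp ⟨c, hc⟩
  have hp' := hΘ p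
  rw [hi] at hp'
  generalize Θ p = s at *
  have heq := (adjD_div_div_eq_iff hB hh).1 hp'
  have hdvd : B * h ∣ s := by
    by_cases hs0 : s = 0
    · rw [hs0]
      exact dvd_zero _
    refine dvd_of_rootMultiplicity_le (mul_ne_zero hB hh) hs0 fun c => ?_
    rw [rootMultiplicity_mul (mul_ne_zero hB hh)]
    by_cases hBc : B.eval c = 0
    · by_contra! hlt
      have hA' := eval_eq_of_rootMultiplicity_lt hs0 hh hB hBc heq (by omega)
      by_cases hcE : c ∈ E
      · have h1 := hm_unique c hcE _ hA'
        rw [hhE c hcE] at h1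
        have h2 : ((s.rootMultiplicity c : ℕ) : K) = 0 := by linear_combination h1
        have h3 := (rootMultiplicity_pos hs0).2 (hpE c hcE)
        exact h3.ne' (by exact_mod_cast h2)
      · rw [hhE' c hcE] at hA' hlt
        have hB1 : B.rootMultiplicity c ≤ 1 := by
          by_contra! hB1
          refine hAc c hBc ?_
          rw [hA', ((one_lt_rootMultiplicity_iff_isRoot hB).1 hB1).2, mul_zero]
        have hs : s.rootMultiplicity c = 0 := by omega
        refine hAc c hBc ?_
        rw [hA', hs]
        simp
    · rw [rootMultiplicity_eq_zero hBc, zero_add]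
      exact rootMultiplicity_le_of_eval_ne_zero hs0 hh hBc heq
  obtain ⟨t, rfl⟩ := hdvd
  refine ⟨t, mul_left_cancel₀ (mul_ne_zero hB (pow_ne_zero 2 hh)) ?_⟩
  simp only [derivative_mul] at heq
  linear_combination -heq

end

/-- Theorem 5.1. Let `f ∈ C(x)`. The first-order operator `L = D + f`
is stable if and only if `f = -h'/h + α` or `f = -h'/h + β/(x-c)` for some nonzero
polynomial `h`, constants `α, β, c ∈ C`, with `β` not a positive integer. -/
theorem first_order_operator_stable_iff {C : Type} [Field C] [IsAlgClosed C] [CharZero C]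
    (f : RatFunc C) :
    stableOf (adjD f) ↔
      ((∃ h : Polynomial C, h ≠ 0 ∧ ∃ α : C,
          f = -(algebraMap (Polynomial C) (RatFunc C) (derivative h) /
                algebraMap (Polynomial C) (RatFunc C) h) + RatFunc.C α) ∨
       (∃ h : Polynomial C, h ≠ 0 ∧ ∃ β c : C, (∀ n : ℕ, 0 < n → β ≠ (n : C)) ∧
          f = -(algebraMap (Polynomial C) (RatFunc C) (derivative h) /
                algebraMap (Polynomial C) (RatFunc C) h) +
              RatFunc.C β / (RatFunc.X - RatFunc.C c))) := by
  constructor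
  · intro hstable
    have hsurj := exists_adjD_eq_of_stableOf hstable
    by_cases hker : ∃ r, r ≠ 0 ∧ adjD f r = 0
    · obtain ⟨r, hr, hr0⟩ := hker
      obtain ⟨h, hh, hf⟩ := exists_eq_neg_logDeriv_of_adjD_eq_zero hsurj hr hr0
      exact Or.inl ⟨h, hh, 0, by rw [hf, map_zero, add_zero]⟩
    have hinj : ∀ r, adjD f r = 0 → r = 0 := fun r hr0 => by
      by_contra hr
      exact hker ⟨r, hr, hr0⟩
    rw [← f.num_div_denom] at hsurj hinj
    obtain ⟨E, m, hBE, hAE, hA, hB⟩ :=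
      exists_negative_residues f.denom_ne_zero f.isCoprime_num_denom hsurj hinj
    obtain ⟨Q, g, hQ, hQdeg, hf⟩ :=
      exists_eq_neg_logDeriv_add_div f.monic_denom E m hBE hAE hA hB
    rw [f.num_div_denom] at hf hinj
    have hh := prod_X_sub_C_pow_ne_zero E m
    set h := ∏ c ∈ E, (X - Polynomial.C c) ^ m c
    rw [RatFunc.algebraMap_C] at hf
    rcases Nat.le_one_iff_eq_zero_or_eq_one.1 hQdeg with hQ0 | hQ1
    · rw [hQ.natDegree_eq_zero.1 hQ0, map_one, div_one] at hf
      exact Or.inl ⟨h, hh, g, hf⟩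
    · have hQX : algebraMap (Polynomial C) (RatFunc C) Q =
          RatFunc.X - RatFunc.C (-Q.coeff 0) := by
        rw [map_neg, sub_neg_eq_add]
        conv_lhs => rw [hQ.eq_X_add_C hQ1]
        rw [map_add, RatFunc.algebraMap_X, RatFunc.algebraMap_C]
      rw [hQX] at hf
      refine Or.inr ⟨h, hh, g, -Q.coeff 0, fun n hn hgn => ?_, hf⟩
      obtain ⟨n, rfl⟩ := Nat.exists_eq_succ_of_ne_zero hn.ne'
      have h0 := adjD_logDeriv_add_div hh (RatFunc.C g / (RatFunc.X - RatFunc.C (-Q.coeff 0)))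
        (algebraMap (Polynomial C) (RatFunc C) ((X - Polynomial.C (-Q.coeff 0)) ^ (n + 1)))
      rw [← hf, adjD_div_X_sub_C_pow, hgn, sub_self, map_zero, zero_mul, map_zero,
        zero_div] at h0
      have hne {p : Polynomial C} : algebraMap (Polynomial C) (RatFunc C) p ≠ 0 ↔ p ≠ 0 :=
        map_ne_zero_iff _ (RatFunc.algebraMap_injective C)
      exact div_ne_zero (hne.2 (pow_ne_zero _ (X_sub_C_ne_zero _))) (hne.2 hh) (hinj _ h0)
  · rintro (⟨h, hh, α, rfl⟩ | ⟨h, hh, β, c, hβ, rfl⟩)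
    · exact stableOf_logDeriv_add hh (stableOf_adjD_C α)
    · exact stableOf_logDeriv_add hh (stableOf_adjD_div_X_sub_C hβ)
end

section
/- Let f ∈ C(x) and L = D + f, and let r ∈ C(x). If L*(r) = -r' + f·r is a nonzero polynomial, then the denominator den(r) of r divides Δ(f); furthermore, every zero of den(r) occurs in den(r) with the same multiplicity as in Δ(f). -/
open Polynomial

/-- The residue of `f` at `c`: the coefficient of `(x-c)⁻¹` in the Laurent expansion
of `f` at `c`. -/
noncomputable def residue {C : Type} [Field C] (f : RatFunc C) (c : C) : C :=
  ((RatFunc.laurent c f : LaurentSeries C)).coeff (-1)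

/-- `c` belongs to `S(f)`: `c` is a simple pole of `f` whose residue is a negative
integer. -/
def memS {C : Type} [Field C] (f : RatFunc C) (c : C) : Prop :=
  f.denom.rootMultiplicity c = 1 ∧ ∃ n : ℕ, 0 < n ∧ residue f c = -(n : C)

/-- The set `S(f)` as a finite set. -/
noncomputable def Sset {C : Type} [Field C] (f : RatFunc C) : Finset C :=
  letI := Classical.decEq C
  letI := Classical.decPred (memS f)
  f.denom.roots.toFinset.filter (memS f)

/-- For `c ∈ S(f)`, the positive integer `n` with `res_c(f) = -n`. -/
noncomputable def negRes {C : Type} [Field C] (f : RatFunc C) (c : C) : ℕ :=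
  letI := Classical.dec (∃ n : ℕ, residue f c = -(n : C))
  if h : ∃ n : ℕ, residue f c = -(n : C) then h.choose else 0

/-- `Δ(f) = ∏_{c ∈ S(f)} (x - c)^{-res_c(f)}`. -/
noncomputable def Delta {C : Type} [Field C] (f : RatFunc C) : Polynomial C :=
  ∏ c ∈ Sset f, (X - Polynomial.C c) ^ negRes f c

theorem residue_eq_div {C : Type} [Field C] (f : RatFunc C) (c : C) (q : C[X])
    (hq : f.denom = (X - Polynomial.C c) * q) (hqc : q.eval c ≠ 0) :
    residue f c = f.num.eval c / q.eval c := by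
  have hf : f = algebraMap C[X] (RatFunc C) f.num /
      algebraMap C[X] (RatFunc C) ((X - Polynomial.C c) * q) := by
    rw [← hq, RatFunc.num_div_denom]
  have hq0 : PowerSeries.constantCoeff (taylor c q : PowerSeries C) = q.eval c := by
    simp [taylor_coeff_zero]
  have hinv : (taylor c q : PowerSeries C) * (taylor c q : PowerSeries C)⁻¹ = 1 :=
    PowerSeries.mul_inv_cancel _ (by rwa [hq0])
  have hinv' := congrArg (HahnSeries.ofPowerSeries ℤ C) hinv
  rw [map_mul, map_one] at hinv'
  have hX : (HahnSeries.single (-1 : ℤ) (1 : C)) * HahnSeries.single (1 : ℤ) (1 : C) = 1 := by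
    rw [HahnSeries.single_mul_single]; simp
  have hX0 : HahnSeries.single (1 : ℤ) (1 : C) ≠ 0 := by simp
  have hQ0 := left_ne_zero_of_mul_eq_one hinv'
  have hcoe (P : C[X]) : ((algebraMap C[X] (RatFunc C) P : RatFunc C) : LaurentSeries C) =
      HahnSeries.ofPowerSeries ℤ C P :=
    (RatFunc.coe_coe P).symm
  have key : (RatFunc.laurent c f : LaurentSeries C) = HahnSeries.single (-1 : ℤ) (1 : C) *
      HahnSeries.ofPowerSeries ℤ C
        ((taylor c f.num : PowerSeries C) * (taylor c q : PowerSeries C)⁻¹) := by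
    rw [hf, RatFunc.laurent_div, ← hf, taylor_mul]
    have : taylor c (X - Polynomial.C c) = X := by simp
    rw [this, map_mul, map_div₀, map_mul]
    rw [RatFunc.algebraMap_X, RatFunc.coe_X, hcoe, hcoe, map_mul]
    rw [div_eq_iff (mul_ne_zero hX0 hQ0)]
    linear_combination
      -HahnSeries.ofPowerSeries ℤ C (taylor c f.num : PowerSeries C) * hinv' -
        HahnSeries.ofPowerSeries ℤ C (taylor c f.num : PowerSeries C) *
        HahnSeries.ofPowerSeries ℤ C (taylor c q : PowerSeries C) *
        HahnSeries.ofPowerSeries ℤ C (taylor c q : PowerSeries C)⁻¹ * hX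
  have hc := HahnSeries.coeff_single_mul_add (r := (1 : C)) (x := HahnSeries.ofPowerSeries ℤ C
    ((taylor c f.num : PowerSeries C) * (taylor c q : PowerSeries C)⁻¹)) (a := 0) (b := (-1 : ℤ))
  rw [zero_add, ← key] at hc
  rw [residue, hc, one_mul]
  have h0 := LaurentSeries.coeff_coe_powerSeries
    ((taylor c f.num : PowerSeries C) * (taylor c q : PowerSeries C)⁻¹) 0
  rw [Nat.cast_zero] at h0
  rw [h0, PowerSeries.coeff_zero_eq_constantCoeff_apply, map_mul,
    PowerSeries.constantCoeff_inv, hq0, div_eq_mul_inv]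
  simp [taylor_coeff_zero]

theorem negRes_eq {C : Type} [Field C] [CharZero C] {f : RatFunc C} {c : C} {n : ℕ}
    (h : residue f c = -(n : C)) : negRes f c = n := by
  have hex : ∃ n : ℕ, residue f c = -(n : C) := ⟨n, h⟩
  rw [negRes, dif_pos hex]
  exact_mod_cast (neg_injective (h.symm.trans hex.choose_spec)).symm

theorem Delta_ne_zero {C : Type} [Field C] (f : RatFunc C) : Delta f ≠ 0 :=
  Finset.prod_ne_zero_iff.mpr fun c _ => pow_ne_zero _ (X_sub_C_ne_zero c)

theorem mem_Sset {C : Type} [Field C] {f : RatFunc C} {c : C} (h : memS f c) : c ∈ Sset f := by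
  classical
  simp only [Sset, Finset.mem_filter, Multiset.mem_toFinset]
  refine ⟨?_, h⟩
  rw [← Multiset.count_pos, count_roots, h.1]
  exact one_pos

theorem rootMultiplicity_Delta {C : Type} [Field C] {f : RatFunc C} {c : C} (h : memS f c) :
    (Delta f).rootMultiplicity c = negRes f c := by
  classical
  have h0 := Delta_ne_zero f
  rw [Delta] at h0 ⊢
  rw [← count_roots, roots_prod _ _ h0, Multiset.count_bind]
  change ∑ b ∈ Sset f, _ = _
  simp only [roots_pow, roots_X_sub_C, Multiset.count_nsmul, Multiset.count_singleton]
  simp [mem_Sset h]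

theorem polynomial_relation_of_adjD_eq {C : Type} [Field C] {f r : RatFunc C} {d : C[X]}
    (heq : adjD f r = algebraMap C[X] (RatFunc C) d) :
    f.denom * r.num * derivative r.denom =
      r.denom * (d * f.denom * r.denom + f.denom * derivative r.num - f.num * r.num) := by
  have inj := IsFractionRing.injective C[X] (RatFunc C)
  have hM : algebraMap C[X] (RatFunc C) r.denom ≠ 0 :=
    (map_ne_zero_iff _ inj).mpr r.denom_ne_zero
  have hQ : algebraMap C[X] (RatFunc C) f.denom ≠ 0 :=
    (map_ne_zero_iff _ inj).mpr f.denom_ne_zero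
  have hfr : f * r = algebraMap C[X] (RatFunc C) f.num / algebraMap C[X] (RatFunc C) f.denom *
      (algebraMap C[X] (RatFunc C) r.num / algebraMap C[X] (RatFunc C) r.denom) := by
    rw [RatFunc.num_div_denom, RatFunc.num_div_denom]
  rw [adjD, rderiv, hfr] at heq
  apply inj
  simp only [map_mul, map_add, map_sub, map_pow] at heq ⊢
  field_simp at heq
  linear_combination heq

theorem memS_and_residue_eq {C : Type} [Field C] [CharZero C] {f r : RatFunc C} {d : C[X]}
    (heq : adjD f r = algebraMap C[X] (RatFunc C) d) {c : C} (hc : r.denom.eval c = 0) :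
    memS f c ∧ residue f c = -(r.denom.rootMultiplicity c : C) := by
  have rel := polynomial_relation_of_adjD_eq heq
  have not_common_root (g : RatFunc C) (h : g.denom.eval c = 0) : g.num.eval c ≠ 0 := by
    obtain ⟨a, b, hab⟩ := g.isCoprime_num_denom
    intro h'
    simpa [h, h'] using congrArg (eval c) hab
  have hN := not_common_root r hc
  obtain ⟨M, hM, hMc⟩ := exists_eq_pow_rootMultiplicity_mul_and_not_dvd _ r.denom_ne_zero c
  rw [dvd_iff_isRoot, IsRoot.def] at hMc
  have hn : 0 < r.denom.rootMultiplicity c :=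
    (rootMultiplicity_pos r.denom_ne_zero).mpr hc
  obtain ⟨m, hm⟩ := Nat.exists_eq_succ_of_ne_zero hn.ne'
  rw [hm] at hM ⊢
  have hm0 : ((m.succ : ℕ) : C) ≠ 0 := Nat.cast_ne_zero.mpr m.succ_ne_zero
  generalize hE : d * f.denom * r.denom + f.denom * derivative r.num - f.num * r.num = E at rel
  have hd : derivative r.denom = (X - Polynomial.C c) ^ m *
      (Polynomial.C (m.succ : C) * M + (X - Polynomial.C c) * derivative M) := by
    rw [hM, derivative_mul, derivative_X_sub_C_pow]
    simp only [Nat.succ_eq_add_one, Nat.add_sub_cancel, map_natCast]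
    ring
  rw [hd, hM] at rel
  have hXc : X - Polynomial.C c ≠ 0 := X_sub_C_ne_zero c
  have rel' : f.denom * r.num *
      (Polynomial.C (m.succ : C) * M + (X - Polynomial.C c) * derivative M) =
      (X - Polynomial.C c) * (M * E) := by
    apply mul_left_cancel₀ (pow_ne_zero m hXc)
    rw [pow_succ] at rel
    linear_combination rel
  have hfc : f.denom.eval c = 0 := by
    have := congrArg (eval c) rel'
    simp only [eval_mul, eval_add, eval_sub, eval_X, eval_C, sub_self, zero_mul, add_zero,
      mul_eq_zero] at this
    tauto
  obtain ⟨q, hq⟩ := dvd_iff_isRoot.mpr hfc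
  have hev : q.eval c * m.succ = -f.num.eval c := by
    have h1 : q * r.num *
        (Polynomial.C (m.succ : C) * M + (X - Polynomial.C c) * derivative M) = M * E := by
      apply mul_left_cancel₀ hXc
      rw [← rel', hq]
      ring
    have h2 := congrArg (eval c) h1
    rw [← hE] at h2
    simp only [eval_mul, eval_add, eval_sub, eval_X, eval_C, sub_self, zero_mul, add_zero,
      hfc, hc, mul_zero, zero_sub] at h2
    apply mul_left_cancel₀ (mul_ne_zero hN hMc)
    linear_combination h2
  have hqc : q.eval c ≠ 0 := by
    intro h
    rw [h, zero_mul] at hev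
    exact not_common_root f hfc (neg_eq_zero.mp hev.symm)
  have hres : residue f c = -(m.succ : C) := by
    rw [residue_eq_div f c q hq hqc, div_eq_iff hqc]
    linear_combination hev
  refine ⟨⟨?_, m.succ, m.succ_pos, hres⟩, hres⟩
  rw [hq, rootMultiplicity_mul (hq ▸ f.denom_ne_zero), rootMultiplicity_X_sub_C_self,
    rootMultiplicity_eq_zero hqc]

/-- Lemma 4.6. If `L*(r) = -r' + f*r` is a nonzero polynomial, then
`den(r)` divides `Δ(f)`, and every zero of `den(r)` occurs in `den(r)` with the same
multiplicity as in `Δ(f)`. -/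
theorem denom_divides_Delta {C : Type} [Field C] [IsAlgClosed C] [CharZero C]
    (f r : RatFunc C) (d : Polynomial C) (hd : d ≠ 0)
    (heq : adjD f r = algebraMap (Polynomial C) (RatFunc C) d) :
    r.denom ∣ Delta f ∧
    ∀ c : C, r.denom.eval c = 0 →
      r.denom.rootMultiplicity c = (Delta f).rootMultiplicity c := by
  have hmult (c : C) (hc : r.denom.eval c = 0) :
      r.denom.rootMultiplicity c = (Delta f).rootMultiplicity c := by
    obtain ⟨hS, hres⟩ := memS_and_residue_eq heq hc
    rw [rootMultiplicity_Delta hS, negRes_eq hres]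
  refine ⟨?_, hmult⟩
  classical
  rw [IsAlgClosed.dvd_iff_roots_le_roots r.denom_ne_zero (Delta_ne_zero f), Multiset.le_iff_count]
  intro c
  rw [count_roots, count_roots]
  by_cases hc : r.denom.eval c = 0
  · exact (hmult c hc).le
  · rw [rootMultiplicity_eq_zero hc]
    exact Nat.zero_le _
end

section
/- Let f ∈ C(x) and let c ∈ C be a pole of f. If the operator D + f is stable, then the operator D + f + 1/(x - c) is also stable. -/
open Polynomial

namespace RatFunc

variable {C : Type} [Field C]

local notation "ι" => algebraMap (Polynomial C) (RatFunc C)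

theorem rderiv_div (n d : C[X]) (hd : d ≠ 0) :
    rderiv (ι n / ι d) = ι (derivative n * d - n * derivative d) / ι (d ^ 2) := by
  have hι {p : C[X]} (hp : p ≠ 0) : ι p ≠ 0 := algebraMap_ne_zero hp
  set r := ι n / ι d
  have hD : r.denom ≠ 0 := r.denom_ne_zero
  have cross : r.num * d = n * r.denom := by
    apply algebraMap_injective C
    rw [map_mul, map_mul, ← div_eq_div_iff (hι hD) (hι hd), num_div_denom]
  have dcross : derivative (r.num * d) = derivative (n * r.denom) := by rw [cross]
  rw [derivative_mul, derivative_mul] at dcross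
  rw [rderiv, div_eq_div_iff (hι (pow_ne_zero 2 hD)) (hι (pow_ne_zero 2 hd)),
    ← map_mul, ← map_mul]
  congr 1
  linear_combination (d * r.denom) * dcross -
    (r.denom * derivative d + d * derivative r.denom) * cross

theorem rderiv_add (r s : RatFunc C) : rderiv (r + s) = rderiv r + rderiv s := by
  have hr := algebraMap_ne_zero r.denom_ne_zero
  have hs := algebraMap_ne_zero s.denom_ne_zero
  have h : r + s = ι (r.num * s.denom + s.num * r.denom) / ι (r.denom * s.denom) := by
    conv_lhs => rw [← num_div_denom r, ← num_div_denom s]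
    simp only [map_add, map_mul]
    field_simp
  rw [h, rderiv_div _ _ (mul_ne_zero r.denom_ne_zero s.denom_ne_zero), rderiv, rderiv]
  simp only [derivative_mul, map_add, map_sub, map_mul, map_pow]
  field_simp
  ring

theorem rderiv_algebraMap_mul (p : C[X]) (r : RatFunc C) :
    rderiv (ι p * r) = ι (derivative p) * r + ι p * rderiv r := by
  have hr := algebraMap_ne_zero r.denom_ne_zero
  have h : ι p * r = ι (p * r.num) / ι r.denom := by
    conv_lhs => rw [← num_div_denom r]
    rw [map_mul, mul_div_assoc]
  rw [h, rderiv_div _ _ r.denom_ne_zero, rderiv]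
  conv_rhs => enter [1, 2]; rw [← num_div_denom r]
  simp only [derivative_mul, map_add, map_sub, map_mul, map_pow]
  field_simp
  ring

theorem adjD_add (f r s : RatFunc C) : adjD f (r + s) = adjD f r + adjD f s := by
  rw [adjD, rderiv_add, adjD, adjD]
  ring

theorem adjD_algebraMap_mul (f : RatFunc C) (p : C[X]) (r : RatFunc C) :
    adjD f (ι p * r) = ι p * adjD f r - ι (derivative p) * r := by
  rw [adjD, rderiv_algebraMap_mul, adjD]
  ring

theorem adjD_smul (f : RatFunc C) (a : C) (r : RatFunc C) :
    adjD f (a • r) = a • adjD f r := by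
  have h := adjD_algebraMap_mul f (Polynomial.C a) r
  simpa [smul_eq_C_mul] using h

/-- The adjoint of `D + f` as a `C`-linear endomorphism of `C(x)`. -/
noncomputable def adjDLinear (f : RatFunc C) : RatFunc C →ₗ[C] RatFunc C where
  toFun := adjD f
  map_add' := adjD_add f
  map_smul' := adjD_smul f

theorem adjD_add_simple_pole (f r : RatFunc C) (c : C) :
    adjD (f + 1 / (RatFunc.X - RatFunc.C c)) (ι (Polynomial.X - Polynomial.C c) * r) =
      ι (Polynomial.X - Polynomial.C c) * adjD f r := by
  have ht : (RatFunc.X - RatFunc.C c : RatFunc C) ≠ 0 := by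
    simpa using algebraMap_ne_zero (X_sub_C_ne_zero c)
  rw [adjD, rderiv_algebraMap_mul, adjD]
  simp only [derivative_X, derivative_C, sub_zero, map_one, map_sub,
    algebraMap_X, algebraMap_C]
  field_simp
  ring

theorem algebraMap_mem_range_of_stable {f : RatFunc C} (hst : stableOf (adjD f)) (p : C[X]) :
    ι p ∈ LinearMap.range (adjDLinear f) := by
  choose q hq hmem using hst
  let S : Polynomial.Sequence C := ⟨q, hq⟩
  have hS : Submodule.span C (Set.range S) = ⊤ := S.span fun i =>
    (leadingCoeff_ne_zero.2 (S.ne_zero i)).isUnit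
  have hle : Submodule.span C (Set.range S) ≤
      (LinearMap.range (adjDLinear f)).comap
        (Algebra.linearMap C[X] (RatFunc C) |>.restrictScalars C) := by
    rw [Submodule.span_le]
    rintro _ ⟨i, rfl⟩
    exact hmem i
  exact hle (hS ▸ Submodule.mem_top : p ∈ _)

theorem exists_derivative_eq [CharZero C] (p : C[X]) : ∃ q : C[X], derivative q = p := by
  induction p using Polynomial.induction_on' with
  | add p q hp hq =>
    obtain ⟨a, rfl⟩ := hp
    obtain ⟨b, rfl⟩ := hq
    exact ⟨a + b, derivative_add⟩
  | monomial n a =>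
    refine ⟨monomial (n + 1) (a / (n + 1)), ?_⟩
    rw [derivative_monomial]
    have : (n + 1 : C) ≠ 0 := by exact_mod_cast n.succ_ne_zero
    simp [this]

/-- If the image of `L*` contains all polynomials and `L*(u) = 1`, then every rational function
whose denominator divides that of `u` lies in the image of `L*`. -/
theorem div_denom_mem_range [CharZero C] {f u : RatFunc C}
    (hpoly : ∀ p : C[X], ι p ∈ LinearMap.range (adjDLinear f)) (hu : adjD f u = 1) (p : C[X]) :
    ι p / ι u.denom ∈ LinearMap.range (adjDLinear f) := by
  have hmul (q : C[X]) : ι q * u ∈ LinearMap.range (adjDLinear f) := by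
    obtain ⟨w, rfl⟩ := exists_derivative_eq q
    have h : ι (derivative w) * u = ι w - adjDLinear f (ι w * u) := by
      change _ = _ - adjD f _
      rw [adjD_algebraMap_mul, hu]
      ring
    rw [h]
    exact sub_mem (hpoly w) ⟨_, rfl⟩
  obtain ⟨a, b, hab⟩ := u.isCoprime_num_denom
  have hd := algebraMap_ne_zero u.denom_ne_zero
  have h : ι p / ι u.denom = ι (p * a) * u + ι (p * b) := by
    conv_rhs => rw [← num_div_denom u]
    rw [div_eq_iff hd]
    have := congrArg ι (congrArg (p * ·) hab)
    simp only [map_mul, map_add, map_one] at this ⊢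
    field_simp
    linear_combination -this
  rw [h]
  exact add_mem (hmul _) (hpoly _)

/-- If the image of `L*` contains all polynomials and `c` is a pole of `f`, then `1/(x-c)` lies in
the image of `L*`. -/
theorem inv_mem_range [CharZero C] {f : RatFunc C} {c : C} (hc : f.denom.eval c = 0)
    (hpoly : ∀ p : C[X], ι p ∈ LinearMap.range (adjDLinear f)) :
    (ι (Polynomial.X - Polynomial.C c))⁻¹ ∈ LinearMap.range (adjDLinear f) := by
  obtain ⟨u, hu⟩ := hpoly 1
  replace hu : adjD f u = 1 := hu.trans (map_one _)
  have hdiv := div_denom_mem_range hpoly hu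
  set d := u.denom with hd_def
  set t : C[X] := Polynomial.X - Polynomial.C c with ht_def
  have htev : t.eval c = 0 := by simp [t]
  have hd0 : d ≠ 0 := u.denom_ne_zero
  have hd : ι d ≠ 0 := algebraMap_ne_zero hd0
  have ht : ι t ≠ 0 := algebraMap_ne_zero (X_sub_C_ne_zero c)
  by_cases hdc : d.eval c = 0
  · obtain ⟨e, he⟩ := dvd_iff_isRoot.2 hdc
    have h : (ι t)⁻¹ = ι e / ι d := by
      rw [inv_eq_one_div, div_eq_div_iff ht hd, he, map_mul]
      ring
    exact h ▸ hdiv e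
  obtain ⟨b, hb⟩ := dvd_iff_isRoot.2 hc
  have hac : f.num.eval c ≠ 0 := by
    obtain ⟨v, w, hvw⟩ := f.isCoprime_num_denom
    intro h0
    simpa [h0, hc] using congrArg (Polynomial.eval c) hvw
  have heq : f.num * u.num * d =
      f.denom * (d ^ 2 + derivative u.num * d - u.num * derivative d) := by
    apply algebraMap_injective C
    have hf := algebraMap_ne_zero f.denom_ne_zero
    have h := hu
    rw [adjD, rderiv, ← hd_def] at h
    nth_rewrite 3 [← num_div_denom u] at h
    nth_rewrite 1 [← num_div_denom f] at h
    rw [← hd_def] at h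
    simp only [map_mul, map_add, map_sub, map_pow] at h ⊢
    field_simp at h
    linear_combination h
  have hnc : u.num.eval c = 0 := by
    have := congrArg (Polynomial.eval c) heq
    simpa [hc, hac, hdc] using this
  obtain ⟨m, hm⟩ := dvd_iff_isRoot.2 hnc
  rw [← ht_def] at hm hb
  have hne : (d + m).eval c ≠ 0 := by
    intro h0
    rw [hm, hb, derivative_mul] at heq
    have h1 : f.num * m * d =
        b * (d * (d + m) + t * (derivative m * d - m * derivative d)) := by
      apply mul_left_cancel₀ (X_sub_C_ne_zero c)
      rw [← ht_def]
      have : derivative t = 1 := by simp [t]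
      rw [this] at heq
      linear_combination heq
    have h2 := congrArg (Polynomial.eval c) h1
    rw [Polynomial.eval_mul, Polynomial.eval_mul, Polynomial.eval_mul, Polynomial.eval_add,
      Polynomial.eval_mul, Polynomial.eval_mul, h0, htev] at h2
    have hmc : m.eval c = 0 := by simpa [hac, hdc] using h2
    rw [Polynomial.eval_add, hmc, add_zero] at h0
    exact hdc h0
  have hL : adjD f (ι m / ι d) = ι (d + m) / (ι t * ι d) := by
    have h1 := adjD_algebraMap_mul f t (ι m / ι d)
    have h2 : ι t * (ι m / ι d) = u := by
      rw [← mul_div_assoc, ← map_mul, ← hm, num_div_denom]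
    have h3 : derivative t = 1 := by simp [t]
    rw [h2, hu, h3, map_one] at h1
    have h4 : adjD f (ι m / ι d) = (1 + ι m / ι d) / ι t := by
      rw [eq_div_iff ht]
      linear_combination -h1
    rw [h4, map_add]
    field_simp
  set κ : C := (d + m).eval c / d.eval c
  have hκ : κ ≠ 0 := div_ne_zero hne hdc
  obtain ⟨w, hw⟩ : t ∣ d + m - Polynomial.C κ * d := by
    apply dvd_iff_isRoot.2
    simp [IsRoot, κ, hdc]
  have h : (ι t)⁻¹ = κ⁻¹ • (adjDLinear f (ι m / ι d) - ι w / ι d) := by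
    change _ = _ • (adjD f _ - _)
    have hw' := congrArg ι hw
    have hκ' : RatFunc.C κ ≠ 0 := by simpa using hκ
    rw [hL, smul_eq_C_mul, map_inv₀]
    simp only [map_mul, map_add, map_sub, algebraMap_C] at hw' ⊢
    field_simp
    linear_combination -hw'
  rw [h]
  exact Submodule.smul_mem _ _ (sub_mem ⟨_, rfl⟩ (hdiv w))

end RatFunc

/-- Proposition 4.9(2). Let `c` be a pole of `f`. If `D + f` is
stable, then `D + f + 1/(x-c)` is stable. -/
theorem stable_add_simple_pole {C : Type} [Field C] [IsAlgClosed C] [CharZero C]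
    (f : RatFunc C) (c : C) (hc : f.denom.eval c = 0) (hst : stableOf (adjD f)) :
    stableOf (adjD (f + 1 / (RatFunc.X - RatFunc.C c))) := by
  have hpoly := RatFunc.algebraMap_mem_range_of_stable hst
  rintro (_ | i)
  · obtain ⟨r, hr⟩ := RatFunc.inv_mem_range hc hpoly
    refine ⟨1, by simp, _, (RatFunc.adjD_add_simple_pole f r c).trans ?_⟩
    rw [show adjD f r = _ from hr, map_one]
    exact mul_inv_cancel₀ (RatFunc.algebraMap_ne_zero (X_sub_C_ne_zero c))
  · obtain ⟨p, hp, r, hr⟩ := hst i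
    refine ⟨(X - Polynomial.C c) * p, ?_, _, (RatFunc.adjD_add_simple_pole f r c).trans ?_⟩
    · rw [degree_mul, degree_X_sub_C, hp, add_comm]
      rfl
    · rw [hr, map_mul]
end

section
/- Let c_0 ∈ C be nonzero, let c_1, …, c_n ∈ C be pairwise distinct with n ≥ 1, let m_1, …, m_n be positive integers, and set q = c_0 ∏_{i=1}^n (x - c_i)^{m_i}. Let p ∈ C[x] be a nonzero polynomial. If either deg(p) < n - 1 or deg(p) = deg(q) - 1, then p/q is not rationally integrable, i.e. there is no g ∈ C(x) with g' = p/q. -/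
open Polynomial

theorem natDegree_X_mul_derivative_le {C : Type} [Field C] (a : C[X]) :
    (X * derivative a).natDegree ≤ a.natDegree := by
  rw [natDegree_le_iff_coeff_eq_zero]
  intro k hk
  cases k with
  | zero => simp
  | succ k => simp [coeff_X_mul, coeff_derivative, coeff_eq_zero_of_natDegree_lt hk]

theorem coeff_X_mul_derivative {C : Type} [Field C] (a : C[X]) (k : ℕ) :
    (X * derivative a).coeff k = k * a.coeff k := by
  cases k with
  | zero => simp
  | succ k => simp [coeff_X_mul, coeff_derivative, mul_comm]

/-- If two nonzero polynomials have distinct degrees, the degree of the numerator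
`a' b - a b'` of the derivative of their quotient is `deg a + deg b - 1`. -/
theorem natDegree_derivative_mul_sub_mul_derivative {C : Type} [Field C] [CharZero C]
    {a b : C[X]} (ha : a ≠ 0) (hb : b ≠ 0) (hab : a.natDegree ≠ b.natDegree) :
    (derivative a * b - a * derivative b).natDegree + 1 = a.natDegree + b.natDegree := by
  set W := derivative a * b - a * derivative b with hW
  have hXW : X * W = (X * derivative a) * b - a * (X * derivative b) := by rw [hW]; ring
  have hle : (X * W).natDegree ≤ a.natDegree + b.natDegree := by
    rw [hXW]
    refine (natDegree_sub_le_of_le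
      (natDegree_mul_le_of_le (natDegree_X_mul_derivative_le a) le_rfl)
      (natDegree_mul_le_of_le le_rfl (natDegree_X_mul_derivative_le b))).trans
      (max_self _).le
  have hcoeff : (X * W).coeff (a.natDegree + b.natDegree) =
      ((a.natDegree : C) - b.natDegree) * (a.leadingCoeff * b.leadingCoeff) := by
    rw [hXW, coeff_sub,
      coeff_mul_add_eq_of_natDegree_le (natDegree_X_mul_derivative_le a) le_rfl,
      coeff_mul_add_eq_of_natDegree_le le_rfl (natDegree_X_mul_derivative_le b),
      coeff_X_mul_derivative, coeff_X_mul_derivative, leadingCoeff, leadingCoeff]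
    ring
  have hne : (X * W).coeff (a.natDegree + b.natDegree) ≠ 0 := by
    rw [hcoeff]
    refine mul_ne_zero (sub_ne_zero.mpr (by exact_mod_cast hab)) (mul_ne_zero ?_ ?_)
    · exact leadingCoeff_ne_zero.mpr ha
    · exact leadingCoeff_ne_zero.mpr hb
  have hW0 : W ≠ 0 := by
    intro h
    simp [h] at hne
  rw [← natDegree_X_mul hW0]
  exact le_antisymm hle (le_natDegree_of_ne_zero hne)

/-- Subtracting a constant multiple of `b` from `a`, one may assume that `a` and `b` have distinct
degrees without changing the numerator of the derivative of `a / b`. -/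
theorem exists_natDegree_ne_of_derivative_mul_sub_ne_zero {C : Type} [Field C] {a b : C[X]}
    (hW : derivative a * b - a * derivative b ≠ 0) :
    ∃ a₁ : C[X], a₁ ≠ 0 ∧ a₁.natDegree ≠ b.natDegree ∧
      derivative a₁ * b - a₁ * derivative b = derivative a * b - a * derivative b := by
  by_cases hab : a.natDegree = b.natDegree
  · have hb : b ≠ 0 := by
      rintro rfl
      simp at hW
    set t : C := a.leadingCoeff / b.leadingCoeff with ht
    have heq : derivative (a - Polynomial.C t * b) * b - (a - Polynomial.C t * b) * derivative b =
        derivative a * b - a * derivative b := by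
      simp only [derivative_sub, derivative_C_mul]
      ring
    have h0 : a - Polynomial.C t * b ≠ 0 := by
      intro h
      rw [h] at heq
      simp only [derivative_zero, zero_mul, sub_zero] at heq
      exact hW heq.symm
    refine ⟨a - Polynomial.C t * b, h0, fun h => ?_, heq⟩
    refine leadingCoeff_ne_zero.mpr h0 ?_
    rw [leadingCoeff, h, coeff_sub, coeff_C_mul, ht, coeff_natDegree,
      div_mul_cancel₀ _ (leadingCoeff_ne_zero.mpr hb), ← hab,
      coeff_natDegree, sub_self]
  · refine ⟨a, ?_, hab, rfl⟩
    rintro rfl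
    simp at hW

theorem rootMultiplicity_derivative_mul_sub_mul_derivative_lt {C : Type} [Field C] [CharZero C]
    {a b : C[X]} (hab : IsCoprime a b) (hW : derivative a * b - a * derivative b ≠ 0)
    {t : C} (ht : b.IsRoot t) :
    (derivative a * b - a * derivative b).rootMultiplicity t < b.rootMultiplicity t := by
  have hb : b ≠ 0 := by
    rintro rfl
    simp at hW
  have hpos : 0 < b.rootMultiplicity t := (rootMultiplicity_pos hb).mpr ht
  have hb' : derivative b ≠ 0 := by
    intro h
    rw [eq_C_of_derivative_eq_zero h] at hb ht
    simp only [IsRoot.def, eval_C] at ht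
    simp [ht] at hb
  by_contra! hle
  have hdvd := (le_rootMultiplicity_iff hW).mp hle
  have hbdvd : (X - Polynomial.C t) ^ b.rootMultiplicity t ∣ b := pow_rootMultiplicity_dvd b t
  have hdvd' : (X - Polynomial.C t) ^ b.rootMultiplicity t ∣ a * derivative b := by
    have := dvd_sub (hbdvd.mul_left (derivative a)) hdvd
    rwa [sub_sub_cancel] at this
  have hcop : IsCoprime ((X - Polynomial.C t) ^ b.rootMultiplicity t) a :=
    (hab.of_isCoprime_of_dvd_right hbdvd).symm
  have hmul := (le_rootMultiplicity_iff hb').mpr (hcop.dvd_of_dvd_mul_left hdvd')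
  rw [derivative_rootMultiplicity_of_root ht] at hmul
  omega

/-- If `p / q = (a / b)'` with `a` and `b` coprime, each root of `q` contributes at least one more
to the degree of `q` than to that of `b`. -/
theorem natDegree_add_card_le_of_mul_sq_eq {C : Type} [Field C] [IsAlgClosed C] [CharZero C]
    {a b p q : C[X]} (hab : IsCoprime a b) (hq : q ≠ 0) (hp : p ≠ 0) (hb : b ≠ 0)
    (h : p * b ^ 2 = q * (derivative a * b - a * derivative b))
    {s : Finset C} (hs : ∀ t ∈ s, q.IsRoot t) :
    b.natDegree + s.card ≤ q.natDegree := by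
  classical
  have hpb : p * b ^ 2 ≠ 0 := mul_ne_zero hp (pow_ne_zero 2 hb)
  have hW : derivative a * b - a * derivative b ≠ 0 := by
    intro h0
    rw [h, h0, mul_zero] at hpb
    exact hpb rfl
  have hle : b.roots + s.val ≤ q.roots := by
    rw [Multiset.le_iff_count]
    intro t
    rw [Multiset.count_add, count_roots, count_roots]
    have hcount : s.val.count t ≤ 1 := Multiset.nodup_iff_count_le_one.mp s.nodup t
    by_cases ht : b.IsRoot t
    · have hlt := rootMultiplicity_derivative_mul_sub_mul_derivative_lt hab hW ht
      have hmult := congrArg (rootMultiplicity t) h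
      rw [rootMultiplicity_mul hpb, rootMultiplicity_mul (mul_ne_zero hq hW), sq,
        rootMultiplicity_mul (mul_ne_zero hb hb)] at hmult
      omega
    · rw [rootMultiplicity_eq_zero ht, zero_add]
      by_cases hts : t ∈ s
      · exact hcount.trans ((rootMultiplicity_pos hq).mpr (hs t hts))
      · rw [Multiset.count_eq_zero_of_notMem hts]
        exact Nat.zero_le _
  calc b.natDegree + s.card = Multiset.card (b.roots + s.val) := by
        rw [Multiset.card_add, (IsAlgClosed.splits b).natDegree_eq_card_roots, Finset.card_def]
    _ ≤ Multiset.card q.roots := Multiset.card_le_card hle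
    _ ≤ q.natDegree := card_roots' q

/-- Lemma 6.2. Let `q = c₀ ∏_{i=1}^n (x - c_i)^{m_i}` with the `c_i`
pairwise distinct, `n ≥ 1` and all `m_i ≥ 1`, and let `p` be a nonzero polynomial. If
`deg p < n - 1` or `deg p = deg q - 1`, then `p/q` is not rationally integrable. -/
theorem not_rationally_integrable {C : Type} [Field C] [IsAlgClosed C] [CharZero C]
    (n : ℕ) (hn : 1 ≤ n) (c₀ : C) (hc₀ : c₀ ≠ 0) (c : Fin n → C)
    (hc : Function.Injective c) (m : Fin n → ℕ) (hm : ∀ i, 0 < m i)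
    (p : Polynomial C) (hp : p ≠ 0)
    (hdeg : p.natDegree < n - 1 ∨ p.natDegree + 1 =
      (Polynomial.C c₀ * ∏ i, (X - Polynomial.C (c i)) ^ m i).natDegree) :
    ¬∃ g : RatFunc C, rderiv g =
      algebraMap (Polynomial C) (RatFunc C) p /
        algebraMap (Polynomial C) (RatFunc C)
          (Polynomial.C c₀ * ∏ i, (X - Polynomial.C (c i)) ^ m i) := by
  rintro ⟨g, hg⟩
  set q : C[X] := Polynomial.C c₀ * ∏ i, (X - Polynomial.C (c i)) ^ m i with hq
  have hq0 : q ≠ 0 := mul_ne_zero (C_ne_zero.mpr hc₀)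
    (Finset.prod_ne_zero_iff.mpr fun i _ => pow_ne_zero _ (X_sub_C_ne_zero _))
  have hb : g.denom ≠ 0 := g.denom_ne_zero
  have h : p * g.denom ^ 2 =
      q * (derivative g.num * g.denom - g.num * derivative g.denom) := by
    rw [rderiv, div_eq_div_iff (RatFunc.algebraMap_ne_zero (pow_ne_zero 2 hb))
      (RatFunc.algebraMap_ne_zero hq0), ← map_mul, ← map_mul] at hg
    rw [← RatFunc.algebraMap_injective C hg, mul_comm]
  have hW : derivative g.num * g.denom - g.num * derivative g.denom ≠ 0 := by
    intro h0
    rw [h0, mul_zero] at h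
    exact mul_ne_zero hp (pow_ne_zero 2 hb) h
  obtain ⟨a, ha, hdeg_ne, hWa⟩ := exists_natDegree_ne_of_derivative_mul_sub_ne_zero hW
  have hWdeg := natDegree_derivative_mul_sub_mul_derivative ha hb hdeg_ne
  rw [hWa] at hWdeg
  have hdegrees := congrArg natDegree h
  rw [natDegree_mul hp (pow_ne_zero 2 hb), natDegree_pow, natDegree_mul hq0 hW] at hdegrees
  rcases hdeg with hdeg | hdeg
  · have hroot : ∀ t ∈ Finset.univ.map ⟨c, hc⟩, q.IsRoot t := by
      simp only [Finset.mem_map, Finset.mem_univ, true_and, Function.Embedding.coeFn_mk,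
        forall_exists_index, forall_apply_eq_imp_iff]
      intro i
      rw [IsRoot.def, hq, eval_mul, eval_prod,
        Finset.prod_eq_zero (Finset.mem_univ i) (by simp [(hm i).ne']), mul_zero]
    have hcard := natDegree_add_card_le_of_mul_sq_eq g.isCoprime_num_denom hq0 hp hb h hroot
    rw [Finset.card_map, Finset.card_univ, Fintype.card_fin] at hcard
    omega
  · omega
end

section
/- Let c_1, …, c_n ∈ C be pairwise distinct with n ≥ 1, let m_1, …, m_n be positive integers, set q = ∏_{i=1}^n (x - c_i)^{m_i}, N = Σ_{i=1}^n m_i, and let L = D + q'/q. Then for every nonnegative integer j, there exists a polynomial d ∈ C[x] of degree j such that -r' + (q'/q)·r = d has a solution r ∈ C(x) if and only if either n - 1 ≤ j ≤ N - 2 or j ≥ N; in particular no such d of degree j exists when j < n - 1 or j = N - 1. -/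
open Polynomial

section LogDerivative

variable {C : Type} [Field C]

theorem adjD_eq_iff (q d : C[X]) (hq : q ≠ 0) (r : RatFunc C) :
    adjD (algebraMap C[X] (RatFunc C) (derivative q) / algebraMap C[X] (RatFunc C) q) r =
        algebraMap C[X] (RatFunc C) d ↔
      q * r.num * derivative r.denom + r.denom * (derivative q * r.num - derivative r.num * q) =
        d * q * r.denom ^ 2 := by
  have hb := r.denom_ne_zero
  have hq' : algebraMap C[X] (RatFunc C) q ≠ 0 := RatFunc.algebraMap_ne_zero hq
  have hb' : algebraMap C[X] (RatFunc C) r.denom ≠ 0 := RatFunc.algebraMap_ne_zero hb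
  have hr : r = algebraMap C[X] (RatFunc C) r.num / algebraMap C[X] (RatFunc C) r.denom :=
    (RatFunc.num_div_denom r).symm
  rw [← (RatFunc.algebraMap_injective C).eq_iff]
  unfold adjD rderiv
  generalize r.num = a at *
  generalize r.denom = b at *
  subst hr
  simp only [map_add, map_sub, map_mul, map_pow]
  field_simp
  constructor <;> intro h <;> linear_combination h

theorem X_sub_C_mul_derivative_pow_mul (c : C) (k : ℕ) (g : C[X]) :
    (X - Polynomial.C c) * derivative ((X - Polynomial.C c) ^ k * g) =
      (X - Polynomial.C c) ^ k * ((k : C[X]) * g + (X - Polynomial.C c) * derivative g) := by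
  cases k with
  | zero => simp
  | succ k =>
    simp only [derivative_mul, derivative_X_sub_C_pow, Nat.add_sub_cancel, map_natCast]
    ring

theorem rootMultiplicity_add_mul_eval_eq_zero {a b q d : C[X]} (hb : b ≠ 0) (hq : q ≠ 0)
    (h : q * a * derivative b + b * (derivative q * a - derivative a * q) = d * q * b ^ 2)
    (c : C) :
    ((b.rootMultiplicity c + q.rootMultiplicity c : ℕ) : C) * a.eval c = 0 := by
  obtain ⟨b₁, hb₁, hb₁c⟩ := exists_eq_pow_rootMultiplicity_mul_and_not_dvd b hb c
  obtain ⟨q₁, hq₁, hq₁c⟩ := exists_eq_pow_rootMultiplicity_mul_and_not_dvd q hq c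
  rw [dvd_iff_isRoot, IsRoot.def] at hb₁c hq₁c
  generalize b.rootMultiplicity c = k at *
  generalize q.rootMultiplicity c = m at *
  have hkb := X_sub_C_mul_derivative_pow_mul c k b₁
  have hmq := X_sub_C_mul_derivative_pow_mul c m q₁
  rw [← hb₁] at hkb
  rw [← hq₁] at hmq
  set y : C[X] := X - Polynomial.C c with hy
  have hy0 : y ≠ 0 := X_sub_C_ne_zero c
  have key : q₁ * a * ((k : C[X]) * b₁ + y * derivative b₁) +
      b₁ * (((m : C[X]) * q₁ + y * derivative q₁) * a - y * derivative a * q₁) =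
      y * (d * q₁ * b₁ * b) := by
    apply mul_left_cancel₀ (mul_ne_zero (pow_ne_zero k hy0) (pow_ne_zero m hy0))
    have h1 := congrArg (y * ·) h
    have h2 : q * a * (y * derivative b) + b * ((y * derivative q) * a - y * derivative a * q) =
        y * (d * q * b * b) := by linear_combination h1
    rw [hkb, hmq] at h2
    generalize derivative a = a' at *
    generalize hB : b * d = B
    have h3 : y * (d * q * b * b) = y * (q * b * B) := by rw [← hB]; ring
    have h4 : y * (d * q₁ * b₁ * b) = y * (q₁ * b₁ * B) := by rw [← hB]; ring
    rw [h3, hb₁, hq₁] at h2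
    rw [h4]
    linear_combination h2
  have := congrArg (eval c) key
  simp [hy] at this
  have h5 : (q₁.eval c * b₁.eval c) * (((k + m : ℕ) : C) * a.eval c) = 0 := by
    push_cast
    linear_combination this
  exact (mul_eq_zero.mp h5).resolve_left (mul_ne_zero hq₁c hb₁c)

theorem natDegree_wronskian_of_natDegree_ne [CharZero C] {a q : C[X]} (ha : 1 ≤ a.natDegree)
    (hq : 1 ≤ q.natDegree) (hne : a.natDegree ≠ q.natDegree) :
    derivative q * a - derivative a * q ≠ 0 ∧
      (derivative q * a - derivative a * q).natDegree + 1 = a.natDegree + q.natDegree := by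
  have ha0 : a.leadingCoeff ≠ 0 := leadingCoeff_ne_zero.mpr (by rintro rfl; simp at ha)
  have hq0 : q.leadingCoeff ≠ 0 := leadingCoeff_ne_zero.mpr (by rintro rfl; simp at hq)
  have hda := natDegree_derivative_le a
  have hdq := natDegree_derivative_le q
  obtain ⟨e, he⟩ := Nat.exists_eq_add_of_le' ha
  obtain ⟨f, hf⟩ := Nat.exists_eq_add_of_le' hq
  have h1 : (derivative q * a).coeff (f + (e + 1)) =
      (f + 1) * q.leadingCoeff * a.leadingCoeff := by
    rw [coeff_mul_add_eq_of_natDegree_le (by omega) (by omega), coeff_derivative, leadingCoeff,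
      leadingCoeff, he, hf]
    ring
  have h2 : (derivative a * q).coeff (f + (e + 1)) =
      (e + 1) * q.leadingCoeff * a.leadingCoeff := by
    rw [show f + (e + 1) = e + (f + 1) by ring,
      coeff_mul_add_eq_of_natDegree_le (by omega) (by omega), coeff_derivative, leadingCoeff,
      leadingCoeff, he, hf]
    ring
  have h3 : (derivative q * a - derivative a * q).coeff (f + (e + 1)) ≠ 0 := by
    have : (derivative q * a - derivative a * q).coeff (f + (e + 1)) =
        ((f : C) - e) * (q.leadingCoeff * a.leadingCoeff) := by
      rw [coeff_sub, h1, h2]; ring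
    rw [this]
    refine mul_ne_zero (sub_ne_zero.mpr fun h => hne ?_) (mul_ne_zero hq0 ha0)
    have : f = e := by exact_mod_cast h
    omega
  refine ⟨fun h => h3 (by simp [h]), ?_⟩
  have h4 : (derivative q * a - derivative a * q).natDegree ≤ f + (e + 1) := by
    refine (natDegree_sub_le _ _).trans (max_le ?_ ?_) <;>
      refine natDegree_mul_le.trans ?_ <;> omega
  have h5 := le_natDegree_of_ne_zero h3
  omega

theorem prod_pow_dvd_derivative_mul_prod {ι : Type*} (s : Finset ι) (f : ι → C[X]) (m : ι → ℕ) :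
    (∏ i ∈ s, f i ^ m i) ∣ derivative (∏ i ∈ s, f i ^ m i) * ∏ i ∈ s, f i := by
  classical
  induction s using Finset.induction_on with
  | empty => simp
  | insert i s hi ih =>
    obtain ⟨w, hw⟩ := ih
    rw [Finset.prod_insert hi, Finset.prod_insert hi, derivative_mul]
    have h : derivative (f i ^ m i) * f i = f i ^ m i * (m i * derivative (f i)) := by
      cases m i with
      | zero => simp
      | succ k =>
        simp only [derivative_pow, Nat.add_sub_cancel, map_natCast]
        ring
    refine ⟨m i * derivative (f i) * (∏ i ∈ s, f i) + f i * w, ?_⟩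
    linear_combination (∏ i ∈ s, f i ^ m i) * (∏ i ∈ s, f i) * h + f i ^ m i * f i * hw

end LogDerivative

/-- Proposition 6.3, reformulated. For `q = ∏_{i=1}^n (x - c_i)^{m_i}`
with the `c_i` pairwise distinct, `N = Σ_i m_i`, and `L = D + q'/q`: for every `j ≥ 0`
there exists a polynomial `d` of degree `j` with `-r' + (q'/q)r = d` rationally solvable
if and only if `n - 1 ≤ j ≤ N - 2` or `j ≥ N`. -/
theorem solvable_degrees_log_derivative {C : Type} [Field C] [IsAlgClosed C] [CharZero C]
    (n : ℕ) (hn : 1 ≤ n) (c : Fin n → C) (hc : Function.Injective c)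
    (m : Fin n → ℕ) (hm : ∀ i, 0 < m i) :
    ∀ j : ℕ,
      (∃ d : Polynomial C, d.degree = (j : ℕ) ∧
        ∃ r : RatFunc C,
          adjD (algebraMap (Polynomial C) (RatFunc C)
              (derivative (∏ i, (X - Polynomial.C (c i)) ^ m i)) /
            algebraMap (Polynomial C) (RatFunc C)
              (∏ i, (X - Polynomial.C (c i)) ^ m i)) r =
            algebraMap (Polynomial C) (RatFunc C) d) ↔
      (((n : ℤ) - 1 ≤ (j : ℤ) ∧ (j : ℤ) ≤ ((∑ i, m i : ℕ) : ℤ) - 2) ∨ (∑ i, m i) ≤ j) := by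
  classical
  intro j
  set q : C[X] := ∏ i, (X - Polynomial.C (c i)) ^ m i with hqdef
  have hmonic : q.Monic := monic_prod_of_monic _ _ fun i _ => (monic_X_sub_C _).pow _
  have hq0 : q ≠ 0 := hmonic.ne_zero
  have hqdeg : q.natDegree = ∑ i, m i := by
    rw [hqdef, natDegree_prod_of_monic _ _ fun i _ => (monic_X_sub_C _).pow _]
    simp
  have hnN : n ≤ ∑ i, m i := by
    simpa using Finset.sum_le_sum (s := Finset.univ) fun i _ => Nat.succ_le_of_lt (hm i)
  have hroot : ∀ i, q.IsRoot (c i) := fun i => by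
    rw [← dvd_iff_isRoot]
    exact (dvd_pow_self _ (hm i).ne').trans (Finset.dvd_prod_of_mem _ (Finset.mem_univ i))
  constructor
  · rintro ⟨d, hd, r, hr⟩
    rw [adjD_eq_iff q d hq0] at hr
    have hd0 : d ≠ 0 := by rintro rfl; simp at hd
    have key := rootMultiplicity_add_mul_eval_eq_zero r.denom_ne_zero hq0 hr
    have hb : r.denom = 1 := by
      refine (RatFunc.monic_denom r).eq_one_of_isUnit ?_
      by_contra hu
      have hdeg : r.denom.degree ≠ 0 := fun h => hu (isUnit_iff_degree_eq_zero.mpr h)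
      obtain ⟨z, hz⟩ := IsAlgClosed.exists_root r.denom hdeg
      have hpos := (rootMultiplicity_pos r.denom_ne_zero).mpr hz
      have haz : r.num.eval z = 0 := (mul_eq_zero.mp (key z)).resolve_left
        (Nat.cast_ne_zero.mpr (by omega))
      obtain ⟨u, v, huv⟩ := RatFunc.isCoprime_num_denom r
      have := congrArg (eval z) huv
      simp [haz, hz.eq_zero] at this
    have har : ∀ i, r.num.eval (c i) = 0 := fun i => by
      have hpos := (rootMultiplicity_pos hq0).mpr (hroot i)
      exact (mul_eq_zero.mp (key (c i))).resolve_left (Nat.cast_ne_zero.mpr (by omega))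
    rw [hb] at hr
    set a := r.num - Polynomial.C (r.num.coeff q.natDegree) * q with ha
    have hw : derivative q * a - derivative a * q = d * q := by
      simp only [derivative_one, one_pow] at hr
      simp only [ha, derivative_sub, derivative_C_mul]
      linear_combination hr
    have ha0 : a ≠ 0 := by
      intro h0
      rw [h0] at hw
      simp [hd0, hq0] at hw
    have hna : n ≤ a.natDegree := by
      have := card_le_degree_of_subset_roots (p := a) (Z := Finset.univ.image c) (by
        intro z hz
        simp only [Finset.image_val, Multiset.mem_dedup, Multiset.mem_map] at hz
        obtain ⟨i, -, rfl⟩ := hz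
        rw [mem_roots ha0]
        simp [ha, har i, (hroot i).eq_zero])
      rwa [Finset.card_image_of_injective _ hc, Finset.card_univ, Fintype.card_fin] at this
    have hne : a.natDegree ≠ q.natDegree := by
      intro h
      refine leadingCoeff_ne_zero.mpr ha0 ?_
      rw [leadingCoeff, h, ha, coeff_sub, coeff_C_mul, hmonic.coeff_natDegree, mul_one, sub_self]
    have hdeg := (natDegree_wronskian_of_natDegree_ne (by omega) (by omega) hne).2
    rw [hw, natDegree_mul hd0 hq0, natDegree_eq_of_degree_eq_some hd] at hdeg
    omega
  · intro hj
    set p : C[X] := ∏ i, (X - Polynomial.C (c i)) with hpdef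
    have hpm : p.Monic := monic_prod_of_monic _ _ fun i _ => monic_X_sub_C _
    have hpdeg : p.natDegree = n := by
      rw [hpdef, natDegree_prod_of_monic _ _ fun i _ => monic_X_sub_C _]
      simp
    set a := p * X ^ (j + 1 - n) with ha
    have hadeg : a.natDegree = j + 1 := by
      rw [ha, hpm.natDegree_mul (monic_X_pow _), natDegree_X_pow, hpdeg]
      omega
    obtain ⟨hw0, hwdeg⟩ := natDegree_wronskian_of_natDegree_ne (a := a) (q := q) (by omega)
      (by omega) (by omega)
    obtain ⟨d, hd⟩ : q ∣ derivative q * a - derivative a * q := by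
      refine dvd_sub ?_ (dvd_mul_left _ _)
      rw [ha, ← mul_assoc]
      exact (prod_pow_dvd_derivative_mul_prod _ _ _).mul_right _
    have hd0 : d ≠ 0 := by
      rintro rfl
      exact hw0 (by simpa using hd)
    refine ⟨d, ?_, algebraMap C[X] (RatFunc C) a, ?_⟩
    · rw [hd, natDegree_mul hq0 hd0] at hwdeg
      rw [degree_eq_natDegree hd0, show d.natDegree = j by omega]
    · rw [adjD_eq_iff q d hq0]
      simp only [RatFunc.num_algebraMap, RatFunc.denom_algebraMap, derivative_one]
      linear_combination hd
end
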